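/- arXiv:1410.8726 — 4 statements merged into one kernel-verified Lean document; each statement's English description precedes it below -/
import Mathlib

section
/- Let n ≥ 2 and let G ≤ S_n. Then the group V_n(G) is isomorphic (as an abstract group) to the Higman–Thompson group V_n if and only if G is semiregular. -/
open scoped Classical Pointwise

/-- The group of self-homeomorphisms of a topological space, with
`(f * g) x = f (g x)`. -/
instance homeoGroup (X : Type*) [TopologicalSpace X] : Group (X ≃ₜ X) where
  mul a b := b.trans a
  one := Homeomorph.refl X
  inv := Homeomorph.symm
  mul_assoc a b c := Homeomorph.ext fun _ => rfl
  one_mul a := Homeomorph.ext fun _ => rfl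
  mul_one a := Homeomorph.ext fun _ => rfl
  inv_mul_cancel a := Homeomorph.ext fun x => a.symm_apply_apply x

/-- The `n`-ary Cantor space: infinite sequences over an `n`-letter alphabet. -/
abbrev Cantor (n : ℕ) := ℕ → Fin n

/-- Prefix a sequence by a finite word. -/
def appendWord {n : ℕ} (θ : List (Fin n)) (x : Cantor n) : Cantor n :=
  fun i => if h : i < θ.length then θ.get ⟨i, h⟩ else x (i - θ.length)

/-- `x` lies in the cone `[θ]`, i.e. has `θ` as a prefix. -/
def inCone {n : ℕ} (θ : List (Fin n)) (x : Cantor n) : Prop :=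
  ∀ i, (h : i < θ.length) → x i = θ.get ⟨i, h⟩

/-- A map is a prefix-substitution map if it is given by two partitions of the
Cantor space into cones `[α i]` resp. `[β i]`, replacing the prefix `α i` by `β i`. -/
def IsPrefixMap {n : ℕ} (v : Cantor n → Cantor n) : Prop :=
  ∃ (t : ℕ) (α β : Fin t → List (Fin n)),
    (∀ x : Cantor n, ∃! i, inCone (α i) x) ∧
    (∀ x : Cantor n, ∃! i, inCone (β i) x) ∧
    ∀ (i : Fin t) (γ : Cantor n), v (appendWord (α i) γ) = appendWord (β i) γ

/-- The Higman–Thompson group `V_n`, as a subgroup of the homeomorphism group of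
the `n`-ary Cantor space: the group of all prefix-substitution homeomorphisms. -/
def HigmanThompson (n : ℕ) : Subgroup (Cantor n ≃ₜ Cantor n) :=
  Subgroup.closure {v | IsPrefixMap ⇑v}

/-- The iterated permutation `[α]_g` (as a function): identity outside the cone
`[α]`, and applying `g` to every letter after the prefix `α` inside it.
With `α = []` this is `[∅]_g`, applying `g` to every letter. -/
noncomputable def iterPermFun {n : ℕ} (α : List (Fin n)) (g : Equiv.Perm (Fin n))
    (x : Cantor n) : Cantor n :=
  if inCone α x then fun i => if i < α.length then x i else g (x i) else x

/-- The group `V_n(G)`: the subgroup of the homeomorphism group of the `n`-ary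
Cantor space generated by `V_n` together with all iterated permutations `[α]_g`
for `g ∈ G` and finite words `α`. -/
def VnG (n : ℕ) (G : Subgroup (Equiv.Perm (Fin n))) : Subgroup (Cantor n ≃ₜ Cantor n) :=
  Subgroup.closure
    ({v | IsPrefixMap ⇑v} ∪
      {v | ∃ (α : List (Fin n)) (g : Equiv.Perm (Fin n)), g ∈ G ∧ ⇑v = iterPermFun α g})

/-- A permutation group is semiregular if no nontrivial element has a fixed point. -/
def Semiregular {n : ℕ} (G : Subgroup (Equiv.Perm (Fin n))) : Prop :=
  ∀ g ∈ G, (∃ x, g x = x) → g = 1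


namespace VG

variable {n : ℕ}

theorem mul_app (a b : Cantor n ≃ₜ Cantor n) (x) : (a * b) x = a (b x) := rfl
theorem one_app (x : Cantor n) : (1 : Cantor n ≃ₜ Cantor n) x = x := rfl
theorem inv_app (a : Cantor n ≃ₜ Cantor n) (x) : a⁻¹ (a x) = x := a.symm_apply_apply x
theorem app_inv (a : Cantor n ≃ₜ Cantor n) (x) : a (a⁻¹ x) = x := a.apply_symm_apply x

def Ag (k : ℕ) (x y : Cantor n) : Prop := ∀ j < k, x j = y j

theorem Ag.refl (k : ℕ) (x : Cantor n) : Ag k x x := fun _ _ => rfl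
theorem Ag.symm {k : ℕ} {x y : Cantor n} (h : Ag k x y) : Ag k y x := fun j hj => (h j hj).symm
theorem Ag.trans {k : ℕ} {x y z : Cantor n} (h : Ag k x y) (h' : Ag k y z) : Ag k x z :=
  fun j hj => (h j hj).trans (h' j hj)
theorem Ag.mono {k l : ℕ} {x y : Cantor n} (h : Ag k x y) (hl : l ≤ k) : Ag l x y :=
  fun j hj => h j (hj.trans_le hl)

theorem Ag_open (k : ℕ) (x : Cantor n) : IsOpen {y | Ag k x y} := by
  have : {y | Ag k x y} = ⋂ j ∈ Finset.range k, {y : Cantor n | x j = y j} := by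
    ext y; simp [Ag]
  rw [this]
  refine isOpen_biInter_finset fun j _ => ?_
  exact (isOpen_discrete {a : Fin n | x j = a}).preimage (continuous_apply j)

theorem Ag_nhds (k : ℕ) (x : Cantor n) : {y | Ag k x y} ∈ nhds x :=
  (Ag_open k x).mem_nhds (Ag.refl k x)

theorem cont_of_fin (f : Cantor n → Cantor n)
    (h : ∀ i, ∃ K, ∀ x y, Ag K x y → f x i = f y i) : Continuous f := by
  refine continuous_pi fun i => ?_
  obtain ⟨K, hK⟩ := h i
  apply IsLocallyConstant.continuous
  rw [IsLocallyConstant.iff_eventually_eq]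
  intro x
  filter_upwards [Ag_nhds K x] with y hy
  exact (hK x y hy).symm

/-- any neighbourhood contains a cone -/
theorem exists_Ag_of_nhds {x : Cantor n} {U : Set (Cantor n)} (hU : U ∈ nhds x) :
    ∃ k, ∀ y, Ag k x y → y ∈ U := by
  rw [nhds_pi, Filter.mem_pi] at hU
  obtain ⟨I, hI, t, ht, hs⟩ := hU
  obtain ⟨k, hk⟩ := hI.bddAbove
  refine ⟨k + 1, fun y hy => hs ?_⟩
  intro i hi
  have := hy i (Nat.lt_succ_of_le (hk hi))
  rw [← this]
  exact mem_of_mem_nhds (ht i)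

theorem cont_coord (h : Cantor n ≃ₜ Cantor n) (x : Cantor n) (i : ℕ) :
    ∃ k, ∀ y, Ag k x y → h y i = h x i := by
  have : Continuous fun y => h y i := (continuous_apply i).comp h.continuous
  have h2 : {y | h y i = h x i} ∈ nhds x :=
    ((isOpen_discrete {a : Fin n | a = h x i}).preimage this).mem_nhds rfl
  exact exists_Ag_of_nhds h2

theorem sep (h : Cantor n ≃ₜ Cantor n) (x : Cantor n) (hx : h x ≠ x) :
    ∃ m, ∀ z w, Ag m x z → Ag m x w → h z ≠ w := by
  obtain ⟨i, hi⟩ := Function.ne_iff.mp hx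
  obtain ⟨k, hk⟩ := cont_coord h x i
  refine ⟨max k (i+1), fun z w hz hw e => hi ?_⟩
  rw [← hk z (hz.mono (le_max_left _ _)), e, hw i (by omega)]

/-- Local form of elements of V_n(G). -/
def LFat (G : Subgroup (Equiv.Perm (Fin n))) (h : Cantor n ≃ₜ Cantor n) (x : Cantor n)
    (k l : ℕ) (g : Equiv.Perm (Fin n)) : Prop :=
  g ∈ G ∧ ∀ y, Ag k x y → Ag l (h x) (h y) ∧ ∀ j, h y (l + j) = g (y (k + j))

def LF (G : Subgroup (Equiv.Perm (Fin n))) (h : Cantor n ≃ₜ Cantor n) : Prop :=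
  ∀ x, ∃ k l g, LFat G h x k l g

theorem LFat.mono {G : Subgroup (Equiv.Perm (Fin n))} {h : Cantor n ≃ₜ Cantor n} {x : Cantor n}
    {k l : ℕ} {g : Equiv.Perm (Fin n)} (H : LFat G h x k l g) (m : ℕ) :
    LFat G h x (k + m) (l + m) g := by
  refine ⟨H.1, fun y hy => ?_⟩
  obtain ⟨h1, h2⟩ := H.2 y (hy.mono (by omega))
  refine ⟨fun j hj => ?_, fun j => ?_⟩
  · by_cases hjl : j < l
    · exact h1 j hjl
    · obtain ⟨i, rfl⟩ := Nat.exists_eq_add_of_le (not_lt.mp hjl)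
      rw [h2, (H.2 x (Ag.refl _ _)).2, hy (k + i) (by omega)]
  · rw [add_assoc, h2, add_assoc]

theorem LFat.move {G : Subgroup (Equiv.Perm (Fin n))} {h : Cantor n ≃ₜ Cantor n} {x x' : Cantor n}
    {k l : ℕ} {g : Equiv.Perm (Fin n)} (H : LFat G h x k l g) (hx : Ag k x x') :
    LFat G h x' k l g := by
  refine ⟨H.1, fun y hy => ?_⟩
  obtain ⟨h1, h2⟩ := H.2 y (hx.trans hy)
  exact ⟨(H.2 x' hx).1.symm.trans h1, h2⟩

theorem LF.mul {G : Subgroup (Equiv.Perm (Fin n))} {a b : Cantor n ≃ₜ Cantor n}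
    (ha : LF G a) (hb : LF G b) : LF G (a * b) := by
  intro x
  obtain ⟨k, l, g, H⟩ := hb x
  obtain ⟨k', l', g', H'⟩ := ha (b x)
  have H := H.mono k'
  have H' := H'.mono l
  rw [add_comm k' l] at H'
  refine ⟨k + k', l' + l, g' * g, mul_mem H'.1 H.1, fun y hy => ?_⟩
  obtain ⟨h1, h2⟩ := H.2 y hy
  obtain ⟨h3, h4⟩ := H'.2 _ h1
  refine ⟨h3, fun j => ?_⟩
  rw [mul_app, h4, h2]; rfl

theorem LF.inv {G : Subgroup (Equiv.Perm (Fin n))} {a : Cantor n ≃ₜ Cantor n}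
    (ha : LF G a) : LF G a⁻¹ := by
  intro x
  obtain ⟨k, l, g, H⟩ := ha (a⁻¹ x)
  refine ⟨l, k, g⁻¹, inv_mem H.1, fun y hy => ?_⟩
  let z : Cantor n := fun i => if i < k then a⁻¹ x i else g⁻¹ (y (l + (i - k)))
  have hz : Ag k (a⁻¹ x) z := fun j hj => by simp [z, hj]
  have hzk : ∀ j, z (k + j) = g⁻¹ (y (l + j)) := fun j => by simp [z]
  obtain ⟨h1, h2⟩ := H.2 z hz
  have e : a z = y := by
    funext i
    by_cases hi : i < l
    · rw [← h1 i hi, app_inv, hy i hi]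
    · obtain ⟨j, rfl⟩ := Nat.exists_eq_add_of_le (not_lt.mp hi)
      rw [h2, hzk]; simp
  rw [← e, inv_app, e]
  exact ⟨hz, hzk⟩

theorem LF.one {G : Subgroup (Equiv.Perm (Fin n))} : LF G (1 : Cantor n ≃ₜ Cantor n) :=
  fun _ => ⟨0, 0, 1, one_mem _, fun _ _ => ⟨fun _ hj => absurd hj (by omega), fun _ => rfl⟩⟩

theorem appendWord_lt (θ : List (Fin n)) (x : Cantor n) (i : ℕ) (h : i < θ.length) :
    appendWord θ x i = θ[i] := by simp [appendWord, h]
theorem appendWord_add (θ : List (Fin n)) (x : Cantor n) (i : ℕ) :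
    appendWord θ x (θ.length + i) = x i := by simp [appendWord]

theorem inCone_append (θ : List (Fin n)) (x : Cantor n) : inCone θ (appendWord θ x) := by
  intro i h; simp [appendWord, h]

theorem inCone_iff (θ : List (Fin n)) (x : Cantor n) :
    inCone θ x ↔ appendWord θ (fun i => x (θ.length + i)) = x := by
  constructor
  · intro h
    funext i
    by_cases hi : i < θ.length
    · rw [appendWord_lt _ _ _ hi, h i hi]; rfl
    · obtain ⟨j, rfl⟩ := Nat.exists_eq_add_of_le (not_lt.mp hi)
      rw [appendWord_add]
  · intro h
    rw [← h]; exact inCone_append _ _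

theorem inCone_Ag {θ : List (Fin n)} {x y : Cantor n} (h : inCone θ x) (hy : Ag θ.length x y) :
    inCone θ y := fun i hi => by rw [← hy i hi]; exact h i hi

theorem Ag_of_inCone {θ : List (Fin n)} {x y : Cantor n} (h : inCone θ x) (hy : inCone θ y) :
    Ag θ.length x y := fun i hi => by rw [h i hi, hy i hi]

theorem LF_prefix {G : Subgroup (Equiv.Perm (Fin n))} {v : Cantor n ≃ₜ Cantor n}
    (hv : IsPrefixMap v) : LF G v := by
  obtain ⟨t, α, β, hα, -, h⟩ := hv
  intro x
  obtain ⟨i, hi, -⟩ := hα x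
  have key : ∀ y, inCone (α i) y → v y = appendWord (β i) (fun j => y ((α i).length + j)) := by
    intro y hy
    conv_lhs => rw [← (inCone_iff _ _).1 hy]
    exact h i _
  refine ⟨(α i).length, (β i).length, 1, one_mem _, fun y hy => ?_⟩
  have hy' := inCone_Ag hi hy
  rw [key x hi, key y hy']
  exact ⟨Ag_of_inCone (inCone_append _ _) (inCone_append _ _), fun j => appendWord_add _ _ _⟩

theorem LF_iter {G : Subgroup (Equiv.Perm (Fin n))} {v : Cantor n ≃ₜ Cantor n}
    {α : List (Fin n)} {g : Equiv.Perm (Fin n)} (hg : g ∈ G) (hv : ⇑v = iterPermFun α g) :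
    LF G v := by
  intro x
  by_cases hx : inCone α x
  · refine ⟨α.length, α.length, g, hg, fun y hy => ?_⟩
    have hy' := inCone_Ag hx hy
    rw [hv]
    simp only [iterPermFun, hx, hy', if_true]
    refine ⟨fun j hj => ?_, fun j => by simp⟩
    simp [hj, hy j hj]
  · refine ⟨α.length, α.length, 1, one_mem _, fun y hy => ?_⟩
    have hy' : ¬ inCone α y := fun h => hx (inCone_Ag h hy.symm)
    rw [hv]
    simp only [iterPermFun, hx, hy', if_false]
    exact ⟨hy, fun j => rfl⟩

theorem LF_of_mem {G : Subgroup (Equiv.Perm (Fin n))} {v : Cantor n ≃ₜ Cantor n}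
    (hv : v ∈ VnG n G) : LF G v := by
  refine Subgroup.closure_induction ?_ LF.one (fun _ _ _ _ => LF.mul) (fun _ _ => LF.inv) hv
  rintro x (hx | ⟨α, g, hg, hx⟩)
  · exact LF_prefix hx
  · exact LF_iter hg hx

theorem LF_of_mem_HT {v : Cantor n ≃ₜ Cantor n}
    (hv : v ∈ HigmanThompson n) : LF ⊥ v :=
  Subgroup.closure_induction (fun _ hx => LF_prefix hx) LF.one
    (fun _ _ _ _ => LF.mul) (fun _ _ => LF.inv) hv

theorem HT_le (G : Subgroup (Equiv.Perm (Fin n))) : HigmanThompson n ≤ VnG n G :=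
  Subgroup.closure_mono Set.subset_union_left

theorem iter_inv (α : List (Fin n)) (g : Equiv.Perm (Fin n)) (x : Cantor n) :
    iterPermFun α g⁻¹ (iterPermFun α g x) = x := by
  by_cases hx : inCone α x
  · have : inCone α (iterPermFun α g x) := by
      refine inCone_Ag hx fun j hj => ?_
      simp [iterPermFun, hx, hj]
    rw [iterPermFun, if_pos this]
    funext i
    simp only [iterPermFun, hx, if_true]
    split_ifs <;> simp
  · simp [iterPermFun, hx]

theorem iter_cont (α : List (Fin n)) (g : Equiv.Perm (Fin n)) :
    Continuous (iterPermFun α g) := by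
  refine cont_of_fin _ fun i => ⟨max α.length (i+1), fun x y hxy => ?_⟩
  have e := hxy i (by omega)
  have : inCone α x ↔ inCone α y :=
    ⟨fun h => inCone_Ag h (hxy.mono (le_max_left _ _)),
      fun h => inCone_Ag h (hxy.mono (le_max_left _ _)).symm⟩
  simp only [iterPermFun, this]
  split_ifs <;> simp [e]

noncomputable def iterH (α : List (Fin n)) (g : Equiv.Perm (Fin n)) : Cantor n ≃ₜ Cantor n where
  toFun := iterPermFun α g
  invFun := iterPermFun α g⁻¹
  left_inv := iter_inv α g
  right_inv := fun x => by simpa using iter_inv α g⁻¹ x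
  continuous_toFun := iter_cont α g
  continuous_invFun := iter_cont α g⁻¹

theorem iterH_mem {G : Subgroup (Equiv.Perm (Fin n))} (α : List (Fin n)) {g : Equiv.Perm (Fin n)}
    (hg : g ∈ G) : iterH α g ∈ VnG n G :=
  Subgroup.subset_closure (Or.inr ⟨α, g, hg, rfl⟩)

/-- words of length K -/
def wd {K : ℕ} (a : Fin K → Fin n) (γ : Cantor n) : Cantor n := appendWord (List.ofFn a) γ

theorem wd_lt {K : ℕ} (a : Fin K → Fin n) (γ : Cantor n) (i : Fin K) : wd a γ i = a i := by
  simp [wd, appendWord]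
theorem wd_add {K : ℕ} (a : Fin K → Fin n) (γ : Cantor n) (i : ℕ) : wd a γ (K + i) = γ i := by
  simp [wd, appendWord]

theorem wd_eq (K : ℕ) (x : Cantor n) : wd (fun i : Fin K => x i) (fun i => x (K + i)) = x := by
  funext i
  by_cases hi : i < K
  · exact wd_lt _ _ ⟨i, hi⟩
  · obtain ⟨j, rfl⟩ := Nat.exists_eq_add_of_le (not_lt.mp hi)
    rw [wd_add]

theorem wd_inj {K : ℕ} {a b : Fin K → Fin n} {γ δ : Cantor n} (h : wd a γ = wd b δ) :
    a = b ∧ γ = δ := by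
  constructor
  · funext i; rw [← wd_lt a γ, h, wd_lt]
  · funext i; rw [← wd_add a γ, h, wd_add]

theorem inCone_wd {K : ℕ} (a b : Fin K → Fin n) (γ : Cantor n) :
    inCone (List.ofFn a) (wd b γ) ↔ a = b := by
  constructor
  · intro h
    rw [inCone_iff] at h
    exact (wd_inj (a := a) h).1
  · rintro rfl; exact inCone_append _ _

theorem prefix_of_wd (h : Cantor n ≃ₜ Cantor n) (K : ℕ) (b : (Fin K → Fin n) → List (Fin n))
    (H : ∀ a γ, h (wd a γ) = appendWord (b a) γ) : IsPrefixMap h := by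
  let e := (Fintype.equivFin (Fin K → Fin n)).symm
  refine ⟨Fintype.card (Fin K → Fin n), fun i => List.ofFn (e i), fun i => b (e i), ?_, ?_, ?_⟩
  · intro x
    refine ⟨e.symm (fun i : Fin K => x i), ?_, ?_⟩
    · simp only [Equiv.apply_symm_apply]
      rw [← wd_eq K x, inCone_wd, wd_eq]
    · intro i hi
      simp only at hi
      rw [← wd_eq K x, inCone_wd] at hi
      rw [← hi]; simp
  · intro x
    obtain ⟨y, rfl⟩ := h.surjective x
    refine ⟨e.symm (fun i : Fin K => y i), ?_, ?_⟩
    · simp only [Equiv.apply_symm_apply]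
      rw [← wd_eq K y, H, wd_eq]
      exact inCone_append _ _
    · intro i hi
      simp only at hi
      rw [inCone_iff, ← H] at hi
      have := h.injective hi
      rw [← wd_eq K y] at this
      have := (wd_inj this).1
      rw [← this]; simp
  · intro i γ
    exact H _ _

theorem uniform {G : Subgroup (Equiv.Perm (Fin n))} {h : Cantor n ≃ₜ Cantor n} (H : LF G h) :
    ∃ K, ∀ x, ∃ l g, LFat G h x K l g := by
  choose k l g H using H
  obtain ⟨t, -, ht⟩ := (isCompact_univ (X := Cantor n)).elim_nhds_subcover
    (fun x => {y | Ag (k x) x y}) (fun x _ => Ag_nhds _ _)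
  refine ⟨t.sup k, fun x => ?_⟩
  have hx := ht (Set.mem_univ x)
  simp only [Set.mem_iUnion] at hx
  obtain ⟨y, hy, hxy⟩ := hx
  have hk : k y ≤ t.sup k := Finset.le_sup hy
  have := ((H y).move hxy).mono (t.sup k - k y)
  rw [Nat.add_sub_cancel' hk] at this
  exact ⟨_, _, this⟩

theorem uniform_wd (hn : 2 ≤ n) {G : Subgroup (Equiv.Perm (Fin n))} {h : Cantor n ≃ₜ Cantor n}
    (H : LF G h) :
    ∃ K, ∃ b : (Fin K → Fin n) → List (Fin n), ∃ g : (Fin K → Fin n) → Equiv.Perm (Fin n),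
      (∀ a, g a ∈ G) ∧ ∀ a γ, h (wd a γ) = appendWord (b a) (fun i => g a (γ i)) := by
  obtain ⟨K, H⟩ := uniform H
  choose l g H using H
  let z : Cantor n := fun _ => ⟨0, by omega⟩
  refine ⟨K, fun a => List.ofFn (fun i : Fin (l (wd a z)) => h (wd a z) i), fun a => g (wd a z),
    fun a => (H _).1, fun a γ => ?_⟩
  have hag : Ag K (wd a z) (wd a γ) := fun j hj => by
    rw [wd_lt a z ⟨j, hj⟩, wd_lt a γ ⟨j, hj⟩]
  obtain ⟨h1, h2⟩ := (H (wd a z)).2 _ hag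
  rw [← wd_eq (l (wd a z)) (h (wd a γ))]
  unfold wd at *
  congr 1
  · congr 1
    funext i
    exact (h1 i i.2).symm
  · funext i
    rw [h2]
    congr 1
    exact wd_add a γ i

theorem mem_HT_iff (hn : 2 ≤ n) {h : Cantor n ≃ₜ Cantor n} : h ∈ HigmanThompson n ↔ LF ⊥ h := by
  refine ⟨LF_of_mem_HT, fun H => ?_⟩
  obtain ⟨K, b, g, hg, H⟩ := uniform_wd hn H
  refine Subgroup.subset_closure (prefix_of_wd h K b fun a γ => ?_)
  rw [H, Subgroup.mem_bot.1 (hg a)]; rfl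

theorem iterH_wd {K : ℕ} (a b : Fin K → Fin n) (g : Equiv.Perm (Fin n)) (γ : Cantor n) :
    iterH (List.ofFn a) g (wd b γ) = wd b (fun i => if a = b then g (γ i) else γ i) := by
  show iterPermFun _ _ _ = _
  by_cases hab : a = b
  · rw [iterPermFun, if_pos ((inCone_wd _ _ _).2 hab)]
    simp only [hab, if_true, List.length_ofFn]
    funext i
    by_cases hi : i < K
    · rw [if_pos hi, wd_lt b _ ⟨i, hi⟩, wd_lt b _ ⟨i, hi⟩]
    · obtain ⟨j, rfl⟩ := Nat.exists_eq_add_of_le (not_lt.mp hi)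
      rw [if_neg hi, wd_add, wd_add]
  · rw [iterPermFun, if_neg (fun h => hab ((inCone_wd _ _ _).1 h))]
    simp [hab]

theorem exists_r {G : Subgroup (Equiv.Perm (Fin n))} {K : ℕ}
    (g : (Fin K → Fin n) → Equiv.Perm (Fin n)) (hg : ∀ a, g a ∈ G) (A : Finset (Fin K → Fin n)) :
    ∃ r ∈ VnG n G, ∀ a γ, r (wd a γ) = wd a (fun i => if a ∈ A then g a (γ i) else γ i) := by
  induction A using Finset.induction_on with
  | empty => exact ⟨1, one_mem _, fun a γ => by simp⟩
  | insert b A hb ih =>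
    obtain ⟨r, hr, H⟩ := ih
    refine ⟨iterH (List.ofFn b) (g b) * r, mul_mem (iterH_mem _ (hg b)) hr, fun a γ => ?_⟩
    rw [mul_app, H, iterH_wd]
    congr 1
    funext i
    by_cases hab : b = a
    · subst hab; simp [hb]
    · have : a ≠ b := fun h => hab h.symm
      simp [hab, this]

theorem mem_VnG_iff (hn : 2 ≤ n) {G : Subgroup (Equiv.Perm (Fin n))} {h : Cantor n ≃ₜ Cantor n} :
    h ∈ VnG n G ↔ LF G h := by
  refine ⟨LF_of_mem, fun H => ?_⟩
  obtain ⟨K, b, g, hg, H⟩ := uniform_wd hn H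
  obtain ⟨r, hr, hr'⟩ := exists_r g hg Finset.univ
  have : h * r⁻¹ ∈ HigmanThompson n := by
    refine Subgroup.subset_closure (prefix_of_wd _ K b fun a γ => ?_)
    have e : wd a γ = r (wd a (fun i => (g a)⁻¹ (γ i))) := by rw [hr']; simp
    rw [e, mul_app, inv_app, H]; simp
  have := mul_mem (HT_le G this) hr
  rwa [inv_mul_cancel_right] at this


/-! ### semiregular implies isomorphic -/

theorem exists_c {G : Subgroup (Equiv.Perm (Fin n))} (hG : Semiregular G) :
    ∃ c : Fin n → Equiv.Perm (Fin n), (∀ b, c b ∈ G) ∧ ∀ g ∈ G, ∀ b, c (g b) = g * c b := by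
  let rep : Fin n → Fin n := fun b => (Quotient.mk (MulAction.orbitRel G (Fin n)) b).out
  have hrep : ∀ b, ∃ g ∈ G, g (rep b) = b := by
    intro b
    have h1 : (MulAction.orbitRel G (Fin n)).r b (rep b) :=
      Setoid.symm' _ (Quotient.exact (Quotient.out_eq (Quotient.mk (MulAction.orbitRel G (Fin n)) b)))
    obtain ⟨g, hg⟩ := h1
    exact ⟨g.1, g.2, hg⟩
  have hrep2 : ∀ g ∈ G, ∀ b, rep (g b) = rep b := by
    intro g hg b
    have : Quotient.mk (MulAction.orbitRel G (Fin n)) (g b) = Quotient.mk _ b :=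
      Quotient.sound ⟨⟨g, hg⟩, rfl⟩
    simp only [rep, this]
  choose c hc hc2 using hrep
  refine ⟨c, hc, fun g hg b => ?_⟩
  have := hG ((g * c b)⁻¹ * c (g b)) (mul_mem (inv_mem (mul_mem hg (hc b))) (hc _))
    ⟨rep b, by
      rw [Equiv.Perm.mul_apply, Equiv.Perm.inv_eq_iff_eq, Equiv.Perm.mul_apply, hc2]
      conv_lhs => rw [← hrep2 g hg b]
      exact hc2 _⟩
  exact (inv_mul_eq_one.1 this).symm

def phi (c : Fin n → Equiv.Perm (Fin n)) (x : Cantor n) : Cantor n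
  | 0 => x 0
  | j + 1 => (c (x j))⁻¹ (x (j + 1))

def psi (c : Fin n → Equiv.Perm (Fin n)) (y : Cantor n) : Cantor n
  | 0 => y 0
  | j + 1 => c (psi c y j) (y (j + 1))

theorem phi_Ag (c : Fin n → Equiv.Perm (Fin n)) {k : ℕ} {x y : Cantor n} (h : Ag k x y) :
    Ag k (phi c x) (phi c y) := by
  intro j hj
  cases j with
  | zero => exact h 0 hj
  | succ j => simp only [phi]; rw [h j (by omega), h (j+1) hj]

theorem psi_Ag (c : Fin n → Equiv.Perm (Fin n)) {k : ℕ} {x y : Cantor n} (h : Ag k x y) :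
    Ag k (psi c x) (psi c y) := by
  intro j
  induction j with
  | zero => intro hj; exact h 0 hj
  | succ j ih => intro hj; simp only [psi]; rw [ih (by omega), h (j+1) hj]

def phiH (c : Fin n → Equiv.Perm (Fin n)) : Cantor n ≃ₜ Cantor n where
  toFun := phi c
  invFun := psi c
  left_inv := fun x => by
    funext j
    induction j with
    | zero => rfl
    | succ j ih => simp only [psi]; rw [ih]; simp [phi]
  right_inv := fun x => by
    funext j
    cases j with
    | zero => rfl
    | succ j => simp [psi, phi]
  continuous_toFun := cont_of_fin _ fun i => ⟨i+1, fun _ _ h => phi_Ag c h i (by omega)⟩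
  continuous_invFun := cont_of_fin _ fun i => ⟨i+1, fun _ _ h => psi_Ag c h i (by omega)⟩

theorem conj_LF1 {G : Subgroup (Equiv.Perm (Fin n))} {c : Fin n → Equiv.Perm (Fin n)}
    (hc2 : ∀ g ∈ G, ∀ b, c (g b) = g * c b) {h : Cantor n ≃ₜ Cantor n} (H : LF G h) :
    LF ⊥ (phiH c * h * (phiH c)⁻¹) := by
  intro x
  obtain ⟨k, l, g, H⟩ := H (psi c x)
  refine ⟨k + 1, l + 1, 1, one_mem _, fun y hy => ?_⟩
  have hy' := psi_Ag c hy
  obtain ⟨h1, -⟩ := (H.mono 1).2 _ hy'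
  obtain ⟨-, h2⟩ := H.2 _ (hy'.mono (by omega))
  refine ⟨phi_Ag c h1, fun j => ?_⟩
  show phi c (h (psi c y)) (l + 1 + j) = y (k + 1 + j)
  have e : phi c (psi c y) = y := (phiH c).apply_symm_apply y
  conv_rhs => rw [← e]
  rw [show l + 1 + j = (l + j) + 1 by ring, show k + 1 + j = (k + j) + 1 by ring]
  simp only [phi]
  rw [h2, add_assoc l, h2, hc2 g H.1, mul_inv_rev, Equiv.Perm.mul_apply, ← add_assoc]
  simp

theorem conj_LF2 {G : Subgroup (Equiv.Perm (Fin n))} {c : Fin n → Equiv.Perm (Fin n)}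
    (hc : ∀ b, c b ∈ G)
    (hc2 : ∀ g ∈ G, ∀ b, c (g b) = g * c b) {h : Cantor n ≃ₜ Cantor n} (H : LF ⊥ h) :
    LF G ((phiH c)⁻¹ * h * phiH c) := by
  intro x
  obtain ⟨k, l, g, H⟩ := H (phi c x)
  have hg : g = 1 := Subgroup.mem_bot.1 H.1
  subst hg
  have hG : c (psi c (h (phi c x)) l) * (c (x k))⁻¹ ∈ G := mul_mem (hc _) (inv_mem (hc _))
  refine ⟨k + 1, l + 1, _, hG, fun y hy => ?_⟩
  have hy' := phi_Ag c hy
  obtain ⟨h1, -⟩ := (H.mono 1).2 _ hy'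
  obtain ⟨-, h2⟩ := H.2 _ (hy'.mono (by omega))
  have h3 := psi_Ag c h1
  refine ⟨h3, ?_⟩
  show ∀ j, psi c (h (phi c y)) (l + 1 + j) = _
  rw [h3 l (by omega), hy k (by omega)] at *
  set u := psi c (h (phi c y)) with hu
  set g := c (u l) * (c (y k))⁻¹ with hgd
  have step : ∀ j, c (u (l + j)) = g * c (y (k + j)) → u (l + 1 + j) = g (y (k + 1 + j)) := by
    intro j hj
    rw [show l + 1 + j = (l + j) + 1 by ring, show k + 1 + j = (k + j) + 1 by ring]
    have : u (l + j + 1) = c (u (l + j)) (h (phi c y) (l + j + 1)) := rfl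
    rw [this, hj, add_assoc l, h2, ← add_assoc k]
    simp [phi]
  have key : ∀ j, c (u (l + j)) = g * c (y (k + j)) := by
    intro j
    induction j with
    | zero => simp [hgd]
    | succ j ih =>
      have := step j ih
      rw [show l + (j + 1) = l + 1 + j by ring, this, hc2 g hG,
        show k + (j + 1) = k + 1 + j by ring]
  exact fun j => step j (key j)

theorem iso_of_semiregular (hn : 2 ≤ n) {G : Subgroup (Equiv.Perm (Fin n))} (hG : Semiregular G) :
    Nonempty (VnG n G ≃* HigmanThompson n) := by
  obtain ⟨c, hc, hc2⟩ := exists_c hG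
  have : (VnG n G).map (MulAut.conj (phiH c)).toMonoidHom = HigmanThompson n := by
    ext h
    rw [mem_HT_iff hn, Subgroup.mem_map]
    constructor
    · rintro ⟨k, hk, rfl⟩
      exact conj_LF1 hc2 (LF_of_mem hk)
    · intro H
      refine ⟨(phiH c)⁻¹ * h * phiH c, (mem_VnG_iff hn).2 (conj_LF2 hc hc2 H), ?_⟩
      show phiH c * ((phiH c)⁻¹ * h * phiH c) * (phiH c)⁻¹ = h
      group
  exact ⟨((MulAut.conj (phiH c)).subgroupMap (VnG n G)).trans (MulEquiv.subgroupCongr this)⟩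


/-! ### isomorphic implies semiregular -/

open scoped commutatorElement

/-- permute the `k` letters following the first `m` letters, on the cone of depth `m` at `x`. -/
noncomputable def locFun (x : Cantor n) (m k : ℕ) (σ : Equiv.Perm (Fin k → Fin n)) (y : Cantor n) :
    Cantor n :=
  if Ag m x y then
    fun j => if h : m ≤ j ∧ j < m + k then σ (fun i => y (m + i)) ⟨j - m, by omega⟩ else y j
  else y

theorem locFun_Ag (x : Cantor n) (m k : ℕ) (σ : Equiv.Perm (Fin k → Fin n)) (y : Cantor n) :
    Ag m y (locFun x m k σ y) := by
  intro j hj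
  unfold locFun
  split_ifs with h
  · dsimp only
    rw [dif_neg (by omega)]
  · rfl

theorem locFun_win (x : Cantor n) (m k : ℕ) (σ : Equiv.Perm (Fin k → Fin n)) (y : Cantor n)
    (h : Ag m x y) (i : Fin k) : locFun x m k σ y (m + i) = σ (fun i => y (m + i)) i := by
  unfold locFun
  rw [if_pos h, dif_pos (by omega)]
  simp

theorem locFun_mul (x : Cantor n) (m k : ℕ) (σ τ : Equiv.Perm (Fin k → Fin n)) (y : Cantor n) :
    locFun x m k (σ * τ) y = locFun x m k σ (locFun x m k τ y) := by
  by_cases h : Ag m x y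
  · have h' := h.trans (locFun_Ag x m k τ y)
    have e : (fun i : Fin k => locFun x m k τ y (m + i)) = τ (fun i => y (m + i)) := by
      funext i; exact locFun_win x m k τ y h i
    rw [locFun, if_pos h]
    conv_rhs => rw [locFun, if_pos h']
    funext j
    split_ifs with hj
    · rw [e]; rfl
    · rw [locFun, if_pos h, dif_neg hj]
  · have h1 : ∀ ρ, locFun x m k ρ y = y := fun ρ => by rw [locFun, if_neg h]
    rw [h1, h1, h1]

theorem locFun_one (x : Cantor n) (m k : ℕ) (y : Cantor n) : locFun x m k 1 y = y := by
  unfold locFun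
  split_ifs with h
  · funext j
    split_ifs with hj
    · simp only [Equiv.Perm.one_apply]
      congr 1; omega
    · rfl
  · rfl

theorem locFun_cont (x : Cantor n) (m k : ℕ) (σ : Equiv.Perm (Fin k → Fin n)) :
    Continuous (locFun x m k σ) := by
  refine cont_of_fin _ fun i => ⟨max (m + k) (i + 1), fun y z hyz => ?_⟩
  have e := hyz i (by omega)
  have h1 : Ag m x y ↔ Ag m x z :=
    ⟨fun h => h.trans (hyz.mono (by omega)), fun h => h.trans (hyz.mono (by omega)).symm⟩
  have h2 : (fun i : Fin k => y (m + i)) = fun i : Fin k => z (m + i) := by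
    funext i; exact hyz _ (by omega)
  unfold locFun
  by_cases h : Ag m x y
  · rw [if_pos h, if_pos (h1.1 h), h2, e]
  · rw [if_neg h, if_neg (fun h' => h (h1.2 h')), e]

noncomputable def locH (x : Cantor n) (m k : ℕ) :
    Equiv.Perm (Fin k → Fin n) →* (Cantor n ≃ₜ Cantor n) where
  toFun σ :=
    { toFun := locFun x m k σ
      invFun := locFun x m k σ⁻¹
      left_inv := fun y => by rw [← locFun_mul, inv_mul_cancel, locFun_one]
      right_inv := fun y => by rw [← locFun_mul, mul_inv_cancel, locFun_one]
      continuous_toFun := locFun_cont x m k σ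
      continuous_invFun := locFun_cont x m k σ⁻¹ }
  map_one' := Homeomorph.ext fun y => locFun_one x m k y
  map_mul' σ τ := Homeomorph.ext fun y => locFun_mul x m k σ τ y

theorem locH_app (x : Cantor n) (m k : ℕ) (σ : Equiv.Perm (Fin k → Fin n)) (y : Cantor n) :
    locH x m k σ y = locFun x m k σ y := rfl

theorem locH_supp (x : Cantor n) (m k : ℕ) (σ : Equiv.Perm (Fin k → Fin n)) (y : Cantor n)
    (h : ¬ Ag m x y) : locH x m k σ y = y := by
  rw [locH_app, locFun, if_neg h]

theorem locH_mem (hn : 2 ≤ n) (x : Cantor n) (m k : ℕ) (σ : Equiv.Perm (Fin k → Fin n)) :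
    locH x m k σ ∈ HigmanThompson n := by
  rw [mem_HT_iff hn]
  intro y
  refine ⟨m + k, m + k, 1, one_mem _, fun z hyz => ?_⟩
  have h1 : Ag m x y ↔ Ag m x z :=
    ⟨fun h => h.trans (hyz.mono (by omega)), fun h => h.trans (hyz.mono (by omega)).symm⟩
  have h2 : (fun i : Fin k => y (m + i)) = fun i : Fin k => z (m + i) := by
    funext i; exact hyz _ (by omega)
  rw [locH_app, locH_app]
  unfold locFun
  by_cases h : Ag m x y
  · rw [if_pos h, if_pos (h1.1 h), h2]
    refine ⟨fun j hj => ?_, fun j => ?_⟩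
    · dsimp only
      rw [hyz j hj]
    · rw [dif_neg (by omega)]; rfl
  · rw [if_neg h, if_neg (fun h' => h (h1.2 h'))]
    exact ⟨hyz, fun j => rfl⟩

theorem locH_inj (x : Cantor n) (m k : ℕ) : Function.Injective (locH x m k) := by
  intro σ τ h
  ext w i
  let y : Cantor n := fun j => if hj : m ≤ j ∧ j < m + k then w ⟨j - m, by omega⟩ else x j
  have hy : Ag m x y := fun j hj => by
    simp only [y]; rw [dif_neg (by omega)]
  have hw : (fun i : Fin k => y (m + i)) = w := by
    funext i; simp [y]
  have := congrArg (fun f => f y (m + i)) h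
  simp only [locH_app, locFun_win _ _ _ _ _ hy, hw] at this
  rw [this]

theorem exists_noncomm (hn : 2 ≤ n) (x : Cantor n) (m : ℕ) :
    ∃ f₁ ∈ HigmanThompson n, ∃ f₂ ∈ HigmanThompson n, ¬ Commute f₁ f₂ ∧
      (∀ y, ¬ Ag m x y → f₁ y = y) ∧ (∀ y, ¬ Ag m x y → f₂ y = y) := by
  have hc : 2 < Fintype.card (Fin 2 → Fin n) := by
    simp; nlinarith
  obtain ⟨a, b, c, hab, hac, hbc⟩ := Fintype.two_lt_card_iff.1 hc
  refine ⟨locH x m 2 (Equiv.swap a b), locH_mem hn _ _ _ _, locH x m 2 (Equiv.swap b c),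
    locH_mem hn _ _ _ _, fun h => ?_, locH_supp _ _ _ _, locH_supp _ _ _ _⟩
  have h' : Equiv.swap a b * Equiv.swap b c = Equiv.swap b c * Equiv.swap a b := by
    apply locH_inj x m 2
    rw [map_mul, map_mul]; exact h
  have := congrArg (fun f => f a) h'
  simp only [Equiv.Perm.mul_apply, Equiv.swap_apply_left,
    Equiv.swap_apply_of_ne_of_ne hab hac] at this
  exact hbc this

theorem exists_pow_move (hn : 2 ≤ n) (x : Cantor n) (m M : ℕ) (hM : 0 < M) :
    ∃ f ∈ HigmanThompson n, (f ^ M) x ≠ x ∧ (∀ y, ¬ Ag m x y → f y = y) := by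
  have hlt : M < n ^ M := Nat.lt_pow_self (by omega)
  have : NeZero (n ^ M) := ⟨by omega⟩
  have e : (Fin M → Fin n) ≃ ZMod (n ^ M) := Fintype.equivOfCardEq (by simp [ZMod.card])
  let σ : Equiv.Perm (Fin M → Fin n) := e.symm.permCongr (Equiv.addRight 1)
  have hσ : ∀ (j : ℕ) w, (σ ^ j) w = e.symm (e w + j) := by
    intro j w
    induction j with
    | zero => simp
    | succ j ih =>
      rw [pow_succ', Equiv.Perm.mul_apply, ih]
      simp [σ, Equiv.permCongr_apply, add_assoc]
  refine ⟨locH x m M σ, locH_mem hn _ _ _ _, fun h => ?_, locH_supp _ _ _ _⟩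
  rw [← map_pow, locH_app] at h
  have h2 : (σ ^ M) (fun i => x (m + i)) = fun i : Fin M => x (m + i) := by
    funext i
    rw [← locFun_win x m M _ x (Ag.refl _ _), h]
  rw [hσ, Equiv.symm_apply_eq] at h2
  have h3 : ((M : ℕ) : ZMod (n ^ M)) = 0 := by simpa using h2
  rw [ZMod.natCast_eq_zero_iff] at h3
  exact absurd (Nat.le_of_dvd hM h3) (by omega)

theorem comm_of_disj {a b : Cantor n ≃ₜ Cantor n} (h : ∀ y, a y = y ∨ b y = y) : Commute a b := by
  refine Homeomorph.ext fun y => ?_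
  rw [mul_app, mul_app]
  rcases h y with h1 | h1
  · rw [h1]
    rcases h (b y) with h2 | h2
    · exact h2
    · rw [b.injective h2, h1]
  · rw [h1]
    rcases h (a y) with h2 | h2
    · rw [a.injective h2, h1]
    · exact h2.symm

def AD {H : Type*} [Group H] (f g : H) : Prop :=
  ∀ h, ¬ Commute f h → ∃ f₁ f₂, Commute f₁ g ∧ Commute f₂ g ∧
    ⁅⁅h, f₁⁆, f₂⁆ ≠ 1 ∧ Commute ⁅⁅h, f₁⁆, f₂⁆ g

theorem comm_map {H K : Type*} [Group H] [Group K] (e : H ≃* K) (a b : H) :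
    Commute (e a) (e b) ↔ Commute a b := by
  constructor
  · intro h
    apply e.injective
    rw [map_mul, map_mul]; exact h
  · exact fun h => h.map e

theorem AD.map {H K : Type*} [Group H] [Group K] (e : H ≃* K) {f g : H} (h : AD f g) :
    AD (e f) (e g) := by
  intro k hk
  obtain ⟨k, rfl⟩ := e.surjective k
  rw [comm_map] at hk
  obtain ⟨f₁, f₂, h1, h2, h3, h4⟩ := h k hk
  refine ⟨e f₁, e f₂, h1.map e, h2.map e, ?_, ?_⟩
  · rw [← map_commutatorElement, ← map_commutatorElement]
    exact fun h => h3 (e.injective (by rw [h, map_one]))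
  · rw [← map_commutatorElement, ← map_commutatorElement]
    exact h4.map e

theorem coe_comm {Γ : Subgroup (Cantor n ≃ₜ Cantor n)} (a b : Γ) :
    Commute a b ↔ Commute (a : Cantor n ≃ₜ Cantor n) b := by
  constructor
  · exact fun h => congrArg Subtype.val h
  · exact fun h => Subtype.ext h

theorem comm_identity {H : Type*} [Group H] (h f₁ f₂ : H) (h1 : Commute (h * f₁ * h⁻¹) f₁)
    (h2 : Commute (h * f₁ * h⁻¹) f₂) : ⁅⁅h, f₁⁆, f₂⁆ = ⁅f₁⁻¹, f₂⁆ := by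
  rw [commutatorElement_def h f₁]
  generalize h * f₁ * h⁻¹ = u at *
  rw [commutatorElement_def, commutatorElement_def]
  have a1 : u * f₁⁻¹ = f₁⁻¹ * u := h1.inv_right
  have a2 : u * f₂ = f₂ * u := h2
  calc u * f₁⁻¹ * f₂ * (u * f₁⁻¹)⁻¹ * f₂⁻¹ = f₁⁻¹ * (u * f₂) * (u * f₁⁻¹)⁻¹ * f₂⁻¹ := by
        rw [a1]; group
    _ = _ := by rw [a2, a1]; group

theorem AD_of_disj (hn : 2 ≤ n) {Γ : Subgroup (Cantor n ≃ₜ Cantor n)} (hΓ : HigmanThompson n ≤ Γ)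
    (f g : Γ) (hfg : ∀ y, f.1 y = y ∨ g.1 y = y) : AD f g := by
  intro h hh
  rw [coe_comm] at hh
  have : ∃ y, f.1 y ≠ y ∧ h.1 y ≠ y := by
    by_contra! hc
    refine hh (comm_of_disj fun y => ?_)
    by_cases hy : f.1 y = y
    · exact Or.inl hy
    · exact Or.inr (hc y hy)
  obtain ⟨x, hfx, hhx⟩ := this
  obtain ⟨m1, hm1⟩ := sep _ _ hfx
  obtain ⟨m2, hm2⟩ := sep _ _ hhx
  obtain ⟨f₁, hf₁, f₂, hf₂, hnc, s1, s2⟩ := exists_noncomm hn x (max m1 m2)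
  have hg : ∀ a : Cantor n ≃ₜ Cantor n, (∀ y, ¬ Ag (max m1 m2) x y → a y = y) →
      Commute a g.1 := by
    intro a ha
    refine comm_of_disj fun y => ?_
    by_cases hy : Ag (max m1 m2) x y
    · right
      have hy1 : Ag m1 x y := hy.mono (le_max_left _ _)
      exact (hfg y).resolve_left (hm1 y y hy1 hy1)
    · exact Or.inl (ha y hy)
  have hu : ∀ a : Cantor n ≃ₜ Cantor n, (∀ y, ¬ Ag (max m1 m2) x y → a y = y) →
      Commute (h.1 * f₁ * h.1⁻¹) a := by
    intro a ha
    refine comm_of_disj fun y => ?_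
    by_cases hy : Ag (max m1 m2) x y
    · left
      have : ¬ Ag (max m1 m2) x (h.1⁻¹ y) := fun h' =>
        hm2 _ _ (h'.mono (le_max_right _ _)) (hy.mono (le_max_right _ _)) (app_inv _ _)
      rw [mul_app, mul_app, s1 _ this, app_inv]
    · exact Or.inr (ha y hy)
  have c1 : Commute (⟨f₁, hΓ hf₁⟩ : Γ) g := (coe_comm _ _).2 (hg _ s1)
  have c2 : Commute (⟨f₂, hΓ hf₂⟩ : Γ) g := (coe_comm _ _).2 (hg _ s2)
  have e := comm_identity h (⟨f₁, hΓ hf₁⟩ : Γ) ⟨f₂, hΓ hf₂⟩ ((coe_comm _ _).2 (hu _ s1))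
    ((coe_comm _ _).2 (hu _ s2))
  refine ⟨⟨f₁, hΓ hf₁⟩, ⟨f₂, hΓ hf₂⟩, c1, c2, ?_, ?_⟩
  · rw [e]
    intro h1
    rw [commutatorElement_eq_one_iff_commute] at h1
    exact hnc ((coe_comm _ _).1 (Commute.inv_left_iff.1 h1))
  · rw [e, commutatorElement_def]
    exact ((c1.inv_left.mul_left c2).mul_left c1.inv_left.inv_left).mul_left c2.inv_left

theorem pow_fix {a : Cantor n ≃ₜ Cantor n} {y : Cantor n} (h : a y = y) (j : ℕ) :
    (a ^ j) y = y := by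
  induction j with
  | zero => rfl
  | succ j ih => rw [pow_succ, mul_app, h, ih]

theorem pow_fix_dvd {a : Cantor n ≃ₜ Cantor n} {y : Cantor n} {i j : ℕ} (h : (a ^ i) y = y)
    (hd : i ∣ j) : (a ^ j) y = y := by
  obtain ⟨c, rfl⟩ := hd
  rw [pow_mul]; exact pow_fix h c

theorem commutator_supp (h a : Cantor n ≃ₜ Cantor n) (y : Cantor n) (h1 : h y = y)
    (h2 : h (a⁻¹ y) = a⁻¹ y) : ⁅h, a⁆ y = y := by
  rw [commutatorElement_def, mul_app, mul_app, mul_app]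
  have : h⁻¹ (a⁻¹ y) = a⁻¹ y := by conv_lhs => rw [← h2, inv_app]
  rw [this, app_inv, h1]

theorem disj_of_AD (hn : 2 ≤ n) {Γ : Subgroup (Cantor n ≃ₜ Cantor n)} (hΓ : HigmanThompson n ≤ Γ)
    (f g : Γ) (hfg : AD f g) (x : Cantor n) : f.1 x = x ∨ (g.1 ^ 12) x = x := by
  by_contra! hc
  obtain ⟨hf, hg⟩ := hc
  have hgi : ∀ i, 1 ≤ i → i ≤ 4 → (g.1 ^ i) x ≠ x := fun i h1 h4 h =>
    hg (pow_fix_dvd h (by interval_cases i <;> decide))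
  obtain ⟨m0, hm0⟩ := sep _ _ hf
  have hs : ∀ i, ∃ m, 1 ≤ i → i ≤ 4 → ∀ z w, Ag m x z → Ag m x w → (g.1 ^ i) z ≠ w := by
    intro i
    by_cases hi : 1 ≤ i ∧ i ≤ 4
    · obtain ⟨m, hm⟩ := sep _ _ (hgi i hi.1 hi.2)
      exact ⟨m, fun _ _ => hm⟩
    · exact ⟨0, fun h1 h2 => absurd ⟨h1, h2⟩ hi⟩
  choose m hm using hs
  let M := max m0 ((Finset.range 5).sup m)
  have hMi : ∀ i, i ≤ 4 → m i ≤ M := fun i hi =>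
    (Finset.le_sup (f := m) (Finset.mem_range.2 (by omega))).trans (le_max_right _ _)
  obtain ⟨h, hh, hhx, hsupp⟩ := exists_pow_move hn x M 1 one_pos
  rw [pow_one] at hhx
  have hnc : ¬ Commute f (⟨h, hΓ hh⟩ : Γ) := by
    rw [coe_comm]
    intro hcm
    have := congrArg (fun a => a x) hcm
    simp only [mul_app] at this
    have hfx : ¬ Ag M x (f.1 x) := fun ha =>
      hm0 x (f.1 x) (Ag.refl _ _) (ha.mono (le_max_left _ _)) rfl
    rw [hsupp _ hfx] at this
    exact hhx (f.1.injective this)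
  obtain ⟨f₁, f₂, c1, c2, h3, h4⟩ := hfg _ hnc
  rw [coe_comm] at c1 c2 h4
  set k := ⁅⁅(⟨h, hΓ hh⟩ : Γ), f₁⁆, f₂⁆ with hk
  have hk' : k.1 = ⁅⁅h, f₁.1⁆, f₂.1⁆ := rfl
  have hne : ∃ z, k.1 z ≠ z := by
    by_contra! hcon
    exact h3 (Subtype.ext (Homeomorph.ext hcon))
  obtain ⟨z, hz⟩ := hne
  let c : Fin 4 → (Cantor n ≃ₜ Cantor n) := ![1, f₁.1, f₂.1, f₂.1 * f₁.1]
  have hcg : ∀ i, Commute (c i) g.1 := by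
    intro i
    fin_cases i
    · exact Commute.one_left _
    · exact c1
    · exact c2
    · exact c2.mul_left c1
  have hcover : ∀ y, k.1 y ≠ y → ∃ i, Ag M x ((c i)⁻¹ y) := by
    intro y hy
    by_contra! hcon
    apply hy
    rw [hk']
    have e0 : h y = y := hsupp _ (hcon 0)
    have e1 : h (f₁.1⁻¹ y) = f₁.1⁻¹ y := hsupp _ (hcon 1)
    have e2 : h (f₂.1⁻¹ y) = f₂.1⁻¹ y := hsupp _ (hcon 2)
    have e3 : h (f₁.1⁻¹ (f₂.1⁻¹ y)) = f₁.1⁻¹ (f₂.1⁻¹ y) := hsupp _ (hcon 3)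
    exact commutator_supp _ _ _ (commutator_supp _ _ _ e0 e1) (commutator_supp _ _ _ e2 e3)
  have hgz : ∀ j : Fin 5, k.1 ((g.1 ^ (j : ℕ)) z) ≠ (g.1 ^ (j : ℕ)) z := by
    intro j hj
    apply hz
    have hcm : Commute k.1 (g.1 ^ (j : ℕ)) := h4.pow_right j
    have := congrArg (fun a => a z) hcm
    simp only [mul_app] at this
    rw [hj] at this
    exact ((g.1 ^ (j : ℕ)).injective this).symm
  choose p hp using fun j => hcover _ (hgz j)
  obtain ⟨a, b, hab, hpab⟩ := Fintype.exists_ne_map_eq_of_card_lt p (by simp)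
  have key : ∀ a b : Fin 5, a < b → p a = p b → False := by
    intro a b hlt hpab
    have ha := hp a
    have hb := hp b
    rw [← hpab] at hb
    have e : (c (p a))⁻¹ ((g.1 ^ (b : ℕ)) z) =
        (g.1 ^ ((b : ℕ) - a)) ((c (p a))⁻¹ ((g.1 ^ (a : ℕ)) z)) := by
      have hcm : Commute (c (p a))⁻¹ (g.1 ^ ((b : ℕ) - a)) := ((hcg (p a)).inv_left).pow_right _
      have := congrArg (fun u => u ((g.1 ^ (a : ℕ)) z)) hcm
      simp only [mul_app] at this
      rw [← this, ← mul_app (g.1 ^ ((b : ℕ) - a)), ← pow_add,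
        Nat.sub_add_cancel (le_of_lt hlt)]
    have hi : (b : ℕ) - a ≤ 4 := by omega
    have h1 : 1 ≤ (b : ℕ) - a := by
      have : (a : ℕ) < b := hlt
      omega
    exact hm _ h1 hi _ _ (ha.mono (hMi _ hi)) (hb.mono (hMi _ hi)) e.symm
  rcases lt_or_gt_of_ne hab with h' | h'
  · exact key a b h' hpab
  · exact key b a h' hpab.symm


/-- the distinguishing algebraic property -/
def PP {H : Type*} [Group H] (t : H) (N : ℕ) : Prop :=
  ∃ S : Finset H, (∀ h ∈ S, AD h (t * h * t⁻¹)) ∧ ∀ f, (∀ h ∈ S, AD f (h ^ N)) → Commute f t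

theorem PP.map {H K : Type*} [Group H] [Group K] (e : H ≃* K) {t : H} {N : ℕ} (h : PP t N) :
    PP (e t) N := by
  obtain ⟨S, h1, h2⟩ := h
  refine ⟨S.image e, ?_, ?_⟩
  · intro k' hk'
    obtain ⟨k, hk, rfl⟩ := Finset.mem_image.1 hk'
    simpa using (h1 k hk).map e
  · intro f hf
    obtain ⟨f, rfl⟩ := e.surjective f
    rw [comm_map]
    refine h2 f fun k hk => ?_
    have := (hf _ (Finset.mem_image_of_mem e hk)).map e.symm
    simpa using this

/-- first difference computation -/
theorem shift_diff {G : Subgroup (Equiv.Perm (Fin n))} {h : Cantor n ≃ₜ Cantor n} {x y : Cantor n}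
    {k l : ℕ} {g : Equiv.Perm (Fin n)} (H : LFat G h x k l g) (hx : h x = x) {d : ℕ}
    (hy : Ag (k + d) x y) (hd : x (k + d) ≠ y (k + d)) :
    Ag (l + d) x (h y) ∧ x (l + d) ≠ h y (l + d) := by
  obtain ⟨h1, -⟩ := (H.mono d).2 y hy
  obtain ⟨-, h2⟩ := H.2 y (hy.mono (by omega))
  obtain ⟨-, h3⟩ := H.2 x (Ag.refl _ _)
  rw [hx] at h1
  refine ⟨h1, fun e => hd ?_⟩
  rw [h2, ← hx, h3] at e
  exact g.injective e

theorem moved {G : Subgroup (Equiv.Perm (Fin n))} {h : Cantor n ≃ₜ Cantor n} {x y : Cantor n}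
    {k l : ℕ} {g : Equiv.Perm (Fin n)} (H : LFat G h x k l g) (hx : h x = x) (hkl : k ≠ l)
    {d : ℕ} (hy : Ag (k + d) x y) (hd : x (k + d) ≠ y (k + d)) : h y ≠ y := by
  intro e
  obtain ⟨h1, h2⟩ := shift_diff H hx hy hd
  rw [e] at h1 h2
  rcases lt_or_gt_of_ne hkl with hlt | hlt
  · exact hd (h1 _ (by omega))
  · exact h2 (hy _ (by omega))

theorem exists_diff (hn : 2 ≤ n) (x : Cantor n) (d : ℕ) :
    ∃ y, Ag d x y ∧ x d ≠ y d := by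
  have : Nontrivial (Fin n) := Fin.nontrivial_iff_two_le.2 hn
  obtain ⟨a, ha⟩ := exists_ne (x d)
  refine ⟨Function.update x d a, fun j hj => ?_, ?_⟩
  · rw [Function.update_of_ne (by omega)]
  · simpa using ha.symm

theorem fix_open (hn : 2 ≤ n) {s : Cantor n ≃ₜ Cantor n} (hs : LF ⊥ s) {m : ℕ} (hm : 0 < m)
    (hsm : s ^ m = 1) : IsOpen {y | s y = y} := by
  rw [isOpen_iff_mem_nhds]
  intro x hx
  have hx : s x = x := hx
  obtain ⟨k, l, g, H⟩ := hs x
  have hg : g = 1 := Subgroup.mem_bot.1 H.1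
  by_cases hkl : k = l
  · subst hkl
    filter_upwards [Ag_nhds k x] with y hy
    obtain ⟨h1, h2⟩ := H.2 y hy
    show s y = y
    funext i
    by_cases hi : i < k
    · rw [← h1 i hi, hx, hy i hi]
    · obtain ⟨j, rfl⟩ := Nat.exists_eq_add_of_le (not_lt.mp hi)
      rw [h2, hg]; rfl
  · exfalso
    obtain ⟨y, hy, hd⟩ := exists_diff hn x (k + m * k)
    have key : ∀ j ≤ m, Ag (k + (m * k - j * k) + j * l) x ((s ^ j) y) ∧
        x (k + (m * k - j * k) + j * l) ≠ (s ^ j) y (k + (m * k - j * k) + j * l) := by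
      intro j
      induction j with
      | zero => intro _; simpa using ⟨hy, hd⟩
      | succ j ih =>
        intro hj
        obtain ⟨h1, h2⟩ := ih (by omega)
        have hle : (j + 1) * k ≤ m * k := Nat.mul_le_mul_right k hj
        have e1 : k + (m * k - j * k) + j * l = k + (m * k - j * k + j * l) := by ring
        rw [e1] at h1 h2
        have := shift_diff H hx h1 h2
        rw [pow_succ', mul_app]
        have e2 : k + (m * k - (j + 1) * k) + (j + 1) * l = l + (m * k - j * k + j * l) := by
          rw [add_mul, one_mul] at hle
          rw [add_mul, add_mul, one_mul, one_mul]; omega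
        rw [e2]
        exact this
    obtain ⟨h1, h2⟩ := key m le_rfl
    rw [hsm, one_app] at h1 h2
    rw [Nat.sub_self, add_zero] at h1 h2
    rcases lt_or_gt_of_ne hkl with hlt | hlt
    · have := Nat.mul_lt_mul_of_pos_left hlt hm
      exact hd (h1 _ (by omega))
    · have := Nat.mul_lt_mul_of_pos_left hlt hm
      exact h2 (hy _ (by omega))

theorem PP_HT (hn : 2 ≤ n) (s : HigmanThompson n) {m N : ℕ} (hm : 0 < m) (hN : 0 < N)
    (hsm : s ^ m = 1) : PP s N := by
  have hopen : IsOpen {y | s.1 y = y} :=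
    fix_open hn (LF_of_mem_HT s.2) hm (congrArg Subtype.val hsm)
  have hcomp : IsCompact {y | s.1 y = y}ᶜ := hopen.isClosed_compl.isCompact
  have hex : ∀ x, ∃ f : HigmanThompson n, s.1 x ≠ x → ((f.1 ^ N) ^ 12) x ≠ x ∧
      ∀ y, f.1 y = y ∨ (s.1 * f.1 * s.1⁻¹) y = y := by
    intro x
    by_cases hx : s.1 x = x
    · exact ⟨1, fun h => absurd hx h⟩
    obtain ⟨d, hd⟩ := sep _ _ hx
    obtain ⟨f, hf, h1, h2⟩ := exists_pow_move hn x d (N * 12) (by omega)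
    refine ⟨⟨f, hf⟩, fun _ => ⟨by rwa [← pow_mul], fun y => ?_⟩⟩
    by_cases hy : Ag d x y
    · right
      have : ¬ Ag d x (s.1⁻¹ y) := fun h => hd _ _ h hy (app_inv _ _)
      show s.1 (f (s.1⁻¹ y)) = y
      rw [h2 _ this, app_inv]
    · exact Or.inl (h2 _ hy)
  choose F hF using hex
  obtain ⟨T, hT, hcov⟩ := hcomp.elim_nhds_subcover
    (fun x => {z | (((F x).1 ^ N) ^ 12) z ≠ z}) (fun x hx =>
      (isOpen_ne_fun (Homeomorph.continuous _) continuous_id).mem_nhds (hF x hx).1)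
  refine ⟨T.image F, ?_, ?_⟩
  · intro h hh
    obtain ⟨x, hx, rfl⟩ := Finset.mem_image.1 hh
    exact AD_of_disj hn le_rfl _ _ (hF x (hT x hx)).2
  · intro f hf
    rw [coe_comm]
    refine comm_of_disj fun z => ?_
    by_cases hz : s.1 z = z
    · exact Or.inr hz
    · left
      have := hcov (show z ∈ {y | s.1 y = y}ᶜ from hz)
      simp only [Set.mem_iUnion] at this
      obtain ⟨x, hx, hxz⟩ := this
      exact (disj_of_AD hn le_rfl _ _ (hf _ (Finset.mem_image_of_mem F hx)) z).resolve_right hxz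

theorem iterH_nil (g : Equiv.Perm (Fin n)) (y : Cantor n) (i : ℕ) :
    iterH [] g y i = g (y i) := by
  show iterPermFun [] g y i = _
  simp [iterPermFun, inCone]

theorem iterH_nil_inv (g : Equiv.Perm (Fin n)) (y : Cantor n) (i : ℕ) :
    (iterH [] g)⁻¹ y i = g⁻¹ (y i) := iterH_nil g⁻¹ y i

theorem iterH_nil_pow (g : Equiv.Perm (Fin n)) (m : ℕ) (y : Cantor n) (i : ℕ) :
    ((iterH [] g) ^ m) y i = (g ^ m) (y i) := by
  induction m with
  | zero => rfl
  | succ m ih => rw [pow_succ', mul_app, iterH_nil, ih, pow_succ']; rfl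

theorem elliptic_pow {G : Subgroup (Equiv.Perm (Fin n))} {h : Cantor n ≃ₜ Cantor n} {x : Cantor n}
    {k : ℕ} {g : Equiv.Perm (Fin n)} (H : LFat G h x k k g) (hx : h x = x) (m : ℕ) (hm : g ^ m = 1)
    (y : Cantor n) (hy : Ag k x y) : (h ^ m) y = y := by
  have key : ∀ j, Ag k x ((h ^ j) y) ∧ ∀ i, (h ^ j) y (k + i) = (g ^ j) (y (k + i)) := by
    intro j
    induction j with
    | zero => exact ⟨hy, fun i => rfl⟩
    | succ j ih =>
      obtain ⟨h1, h2⟩ := H.2 _ ih.1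
      rw [hx] at h1
      refine ⟨by rw [pow_succ', mul_app]; exact h1, fun i => ?_⟩
      rw [pow_succ', mul_app, h2, ih.2, pow_succ']; rfl
  obtain ⟨h1, h2⟩ := key m
  funext i
  by_cases hi : i < k
  · rw [← h1 i hi, hy i hi]
  · obtain ⟨j, rfl⟩ := Nat.exists_eq_add_of_le (not_lt.mp hi)
    rw [h2, hm]; rfl

theorem disj_conj (hn : 2 ≤ n) {Γ : Subgroup (Cantor n ≃ₜ Cantor n)} (hΓ : HigmanThompson n ≤ Γ)
    (t h : Γ) (hA : AD h (t * h * t⁻¹)) (z : Cantor n) :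
    h.1 z = z ∨ (t.1 * h.1 ^ 12 * t.1⁻¹) z = z := by
  generalize hu : t * h * t⁻¹ = u at hA
  have e : u.1 = t.1 * h.1 * t.1⁻¹ := by rw [← hu]; rfl
  rcases disj_of_AD hn hΓ h u hA z with h1 | h1
  · exact Or.inl h1
  · right
    rw [e, conj_pow] at h1
    exact h1

theorem not_PP (hn : 2 ≤ n) {G : Subgroup (Equiv.Perm (Fin n))} {g : Equiv.Perm (Fin n)}
    (hg : g ∈ G) (hg1 : g ≠ 1) {i : Fin n} (hi : g i = i) {M : ℕ}
    (hM : ∀ g : Equiv.Perm (Fin n), g ^ M = 1) :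
    ¬ PP (⟨iterH [] g, iterH_mem [] hg⟩ : VnG n G) (12 * M) := by
  rintro ⟨S, hS1, hS2⟩
  set t : VnG n G := ⟨iterH [] g, iterH_mem [] hg⟩ with ht
  let x : Cantor n := fun _ => i
  have hgi' : g⁻¹ i = i := by rw [Equiv.Perm.inv_eq_iff_eq, hi]
  have htx' : t.1⁻¹ x = x := funext fun j => by
    rw [ht]; exact (iterH_nil_inv g x j).trans hgi'
  have hloc : ∀ h : VnG n G, ∃ k, h ∈ S → ∀ y, Ag k x y → (h.1 ^ (12 * M)) y = y := by
    intro h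
    by_cases hh : h ∈ S
    swap
    · exact ⟨0, fun h' => absurd h' hh⟩
    have hd := disj_conj hn (HT_le G) t h (hS1 h hh)
    have hd' : ∀ z, (h.1 ^ 12) z = z ∨ (h.1 ^ 12) (t.1⁻¹ z) = t.1⁻¹ z := by
      intro z
      rcases hd z with h1 | h1
      · exact Or.inl (pow_fix h1 12)
      · right
        generalize h.1 ^ 12 = b at h1 ⊢
        generalize t.1 = a at h1 ⊢
        rw [mul_app, mul_app] at h1
        conv_rhs => rw [← h1, inv_app]
    have hx : (h.1 ^ 12) x = x := by
      rcases hd' x with h1 | h1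
      · exact h1
      · rwa [htx'] at h1
    obtain ⟨k, l, g', H⟩ := LF_of_mem (pow_mem h.2 12) x
    by_cases hkl : k = l
    · subst hkl
      refine ⟨k, fun _ y hy => ?_⟩
      rw [pow_mul]
      exact elliptic_pow H hx M (hM g') y hy
    · exfalso
      obtain ⟨y, hy, hyd⟩ := exists_diff hn x (k + 0)
      have hy' : Ag (k + 0) x (t.1⁻¹ y) := fun j hj => by
        rw [ht]
        refine Eq.trans ?_ (iterH_nil_inv g y j).symm
        rw [← hy j hj]; exact hgi'.symm
      have hyd' : x (k + 0) ≠ t.1⁻¹ y (k + 0) := fun e => by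
        rw [ht] at e
        have e := e.trans (iterH_nil_inv g y (k + 0))
        apply hyd
        have : g (x (k + 0)) = y (k + 0) := by rw [e]; simp
        rw [← this]; exact hi.symm
      rcases hd' y with h1 | h1
      · exact moved H hx hkl hy hyd h1
      · exact moved H hx hkl hy' hyd' h1
  choose k hk using hloc
  let K := S.sup k
  have hmv : ∃ j, g j ≠ j := by
    by_contra! hc
    exact hg1 (Equiv.ext hc)
  obtain ⟨j, hj⟩ := hmv
  let w : Cantor n := Function.update x K j
  have hw : Ag K x w := fun r hr => by
    simp only [w]; rw [Function.update_of_ne (by omega)]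
  have hwK : w K = j := by simp [w]
  obtain ⟨f, hf, hfw, hfs⟩ := exists_pow_move hn w (K + 1) 1 one_pos
  rw [pow_one] at hfw
  have hcm := hS2 ⟨f, HT_le G hf⟩ fun h hh => AD_of_disj hn (HT_le G) _ _ fun y => by
    by_cases hy : Ag (K + 1) w y
    · right
      refine hk h hh y ?_
      exact (hw.trans (hy.mono (by omega))).mono (Finset.le_sup hh)
    · exact Or.inl (hfs y hy)
  rw [coe_comm] at hcm
  have := congrArg (fun a => a w) hcm
  simp only [mul_app] at this
  have hnot : ¬ Ag (K + 1) w (t.1 w) := fun h => by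
    have := h K (by omega)
    rw [ht] at this
    have := this.trans (iterH_nil g w K)
    rw [hwK] at this
    exact hj this.symm
  rw [hfs _ hnot] at this
  exact hfw (t.1.injective this).symm

theorem semiregular_of_iso (hn : 2 ≤ n) {G : Subgroup (Equiv.Perm (Fin n))}
    (e : VnG n G ≃* HigmanThompson n) : Semiregular G := by
  rintro g hg ⟨i, hi⟩
  by_contra hg1
  have hM : ∀ g : Equiv.Perm (Fin n), g ^ Fintype.card (Equiv.Perm (Fin n)) = 1 :=
    fun g => pow_card_eq_one
  have hpos : 0 < Fintype.card (Equiv.Perm (Fin n)) := Fintype.card_pos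
  refine not_PP hn hg hg1 hi hM ?_
  set t : VnG n G := ⟨iterH [] g, iterH_mem [] hg⟩ with ht
  have htp : t ^ Fintype.card (Equiv.Perm (Fin n)) = 1 := by
    apply Subtype.ext
    refine Homeomorph.ext fun y => funext fun i => ?_
    refine (iterH_nil_pow g _ y i).trans ?_
    rw [hM]; rfl
  have h1 : PP (e t) (12 * Fintype.card (Equiv.Perm (Fin n))) :=
    PP_HT hn (e t) hpos (by omega) (by rw [← map_pow, htp, map_one])
  have := h1.map e.symm
  rwa [e.symm_apply_apply] at this

end VG

/-- For `n ≥ 2` and `G ≤ S_n`, the group `V_n(G)` is isomorphic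
to the Higman–Thompson group `V_n` if and only if `G` is semiregular. -/
theorem vnG_iso_vn_iff_semiregular (n : ℕ) (hn : 2 ≤ n)
    (G : Subgroup (Equiv.Perm (Fin n))) :
    Nonempty (VnG n G ≃* HigmanThompson n) ↔ Semiregular G := by
  exact ⟨fun ⟨e⟩ => VG.semiregular_of_iso hn e, fun h => VG.iso_of_semiregular hn h⟩
end

section
/- Let n, m ≥ 2, G ≤ S_n and H ≤ S_m. If φ : V_n(G) → V_m(H) is a group isomorphism, then there exists a unique homeomorphism ψ from the n-ary Cantor space 𝔠_n to the m-ary Cantor space 𝔠_m such that (v)φ = ψ^{-1} ∘ v ∘ ψ for every v ∈ V_n(G). -/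
open scoped Classical Pointwise

set_option linter.unusedSectionVars false
section Abstract

structure RGood (Γ X : Type*) [Group Γ] [TopologicalSpace X] [MulAction Γ X] : Prop where
  flip : ∀ p : Γ, p * p = 1 → ∀ x : X, p • x ≠ x → ∀ a : Set X, IsOpen a → x ∈ a →
    ∃ u : Γ, (∃ y : X, u • y ≠ y) ∧ (∀ y : X, u • y ≠ y → y ∈ a ∨ p • y ∈ a) ∧
      ∀ y : X, u • y = y ∨ u • y = p • y
  inv : ∀ y : X, ∀ U : Set X, IsOpen U → y ∈ U → ∃ s : Γ, s * s = 1 ∧ s • y ≠ y ∧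
    (∀ z : X, s • z ≠ z → z ∈ U) ∧ ∃ A : Set X, IsOpen A ∧ y ∈ A ∧
      ∀ c : Set X, IsOpen c → ∀ z ∈ c, s • z ≠ z →
        ∃ v : Γ, (∀ w : X, v • w ≠ w → s • w ≠ w) ∧ ∀ w ∈ A, v • w ∈ c
  three : ∀ U : Set X, IsOpen U → U.Nonempty →
    ∃ t : Γ, (∀ z : X, t • z ≠ z → z ∈ U) ∧ ∃ z : X, (t * t) • z ≠ z

def RU {Γ : Type*} [Group Γ] (p u : Γ) : Prop :=
  u * p = p * u ∧ u * u = 1 ∧ ∀ c : Γ, c * p = p * c → u * (c * u * c⁻¹) = (c * u * c⁻¹) * u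

def RV {Γ : Type*} [Group Γ] (p f : Γ) : Prop := ∀ u, RU p u → f * u = u * f

def RW {Γ : Type*} [Group Γ] (p f : Γ) : Prop := ∀ g, RV p g → f * (g * g) = (g * g) * f

theorem RU_map {Γ Δ : Type*} [Group Γ] [Group Δ] (φ : Γ ≃* Δ) (p u : Γ) :
    RU (φ p) (φ u) ↔ RU p u := by
  unfold RU
  rw [φ.surjective.forall]
  simp only [← map_mul, ← map_inv, φ.injective.eq_iff, ← map_one φ]

theorem RV_map {Γ Δ : Type*} [Group Γ] [Group Δ] (φ : Γ ≃* Δ) (p u : Γ) :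
    RV (φ p) (φ u) ↔ RV p u := by
  unfold RV
  rw [φ.surjective.forall]
  simp only [RU_map, ← map_mul, φ.injective.eq_iff]

theorem RW_map {Γ Δ : Type*} [Group Γ] [Group Δ] (φ : Γ ≃* Δ) (p u : Γ) :
    RW (φ p) (φ u) ↔ RW p u := by
  unfold RW
  rw [φ.surjective.forall]
  simp only [RV_map, ← map_mul, φ.injective.eq_iff]

def RS {Γ : Type*} (X : Type*) [Group Γ] [MulAction Γ X] (p : Γ) : Set X := {x | p • x ≠ x}

variable {Γ X : Type*} [Group Γ] [TopologicalSpace X] [T2Space X] [MulAction Γ X]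
  [ContinuousConstSMul Γ X] [FaithfulSMul Γ X]

theorem RS_open (p : Γ) : IsOpen (RS X p) :=
  isOpen_ne_fun (continuous_const_smul p) continuous_id

theorem rcomm {Γ X : Type*} [Group Γ] [MulAction Γ X] [FaithfulSMul Γ X] (f g : Γ)
    (h : ∀ x : X, f • x = x ∨ g • x = x) : f * g = g * f := by
  apply FaithfulSMul.eq_of_smul_eq_smul (α := X)
  intro x
  rw [mul_smul, mul_smul]
  by_cases hg : g • x = x
  · rw [hg]
    by_cases hf : f • x = x
    · rw [hf, hg]
    · rcases h (f • x) with h1 | h1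
      · exact absurd (smul_left_cancel f h1) hf
      · exact h1.symm
  · have hf := (h x).resolve_right hg
    rw [hf]
    rcases h (g • x) with h1 | h1
    · exact h1
    · exact absurd (smul_left_cancel g h1) hg

theorem rsep (p q : Γ) (x : X) (h : p • x ≠ q • x) :
    ∃ a : Set X, IsOpen a ∧ x ∈ a ∧ ∀ y ∈ a, ∀ z ∈ a, p • y ≠ q • z := by
  obtain ⟨u, v, hu, hv, hxu, hxv, huv⟩ := t2_separation h
  refine ⟨(p • ·) ⁻¹' u ∩ (q • ·) ⁻¹' v, (hu.preimage (continuous_const_smul p)).inter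
    (hv.preimage (continuous_const_smul q)), ⟨hxu, hxv⟩, ?_⟩
  intro y hy z hz he
  have h1 : p • y ∈ u := hy.1
  have h2 : q • z ∈ v := hz.2
  rw [he] at h1
  exact Set.disjoint_left.1 huv h1 h2

theorem RU_supp (hG : RGood Γ X) (p u : Γ) (hu : RU p u) (x : X) (hx : u • x ≠ x) :
    x ∈ closure (RS X p) := by
  by_contra hc
  obtain ⟨hup, huu, hcc⟩ := hu
  obtain ⟨a, ha, hxa, hd⟩ := rsep u (1 : Γ) x (by simpa using hx)
  obtain ⟨t, ht, z, hz⟩ := hG.three (a ∩ (closure (RS X p))ᶜ)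
    (ha.inter isClosed_closure.isOpen_compl) ⟨x, hxa, hc⟩
  have htp : t * p = p * t := by
    apply rcomm (X := X)
    intro y
    by_cases hy : t • y = y
    · exact Or.inl hy
    · right
      by_contra hpy
      exact (ht y hy).2 (subset_closure hpy)
  have hfix : ∀ y ∈ a, t • (u • y) = u • y := by
    intro y hy
    by_contra h
    exact hd y hy _ (ht _ h).1 (by simp)
  have huu' : ∀ y : X, u • u • y = y := fun y => by rw [← mul_smul, huu, one_smul]
  have hz1 : t • z ≠ z := fun h => hz (by rw [mul_smul, h, h])
  have hza : z ∈ a := (ht z hz1).1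
  have htza : t • z ∈ a := (ht _ (fun h => hz1 (smul_left_cancel t h))).1
  have e := congrArg (fun g : Γ => g • (t • z)) (hcc t htp)
  simp only [mul_smul] at e
  have h2 : t⁻¹ • u • t • z = u • t • z := by
    rw [inv_smul_eq_iff, hfix _ htza]
  rw [inv_smul_smul, hfix z hza, huu', h2, huu'] at e
  exact hz (by rw [mul_smul]; exact e.symm)

theorem RU_of_flip (p u : Γ) (hp : p * p = 1) (h : ∀ y : X, u • y = y ∨ u • y = p • y) :
    RU p u := by
  have hpp : ∀ y : X, p • p • y = y := fun y => by rw [← mul_smul, hp, one_smul]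
  have key : ∀ u : Γ, (∀ y : X, u • y = y ∨ u • y = p • y) → ∀ y : X, u • p • y = p • u • y := by
    intro u h y
    rcases h y with h1 | h1 <;> rcases h (p • y) with h2 | h2
    · rw [h2, h1]
    · rw [hpp] at h2
      have h3 := smul_left_cancel u (h2.trans h1.symm)
      rw [h2, h1, h3]
    · have h3 := smul_left_cancel u (h2.trans h1.symm)
      rw [h3, h1, hpp, h3]
    · rw [h2, h1]
  have comm : ∀ u w : Γ, (∀ y : X, u • y = y ∨ u • y = p • y) →
      (∀ y : X, w • y = y ∨ w • y = p • y) → u * w = w * u := by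
    intro u w hu hw
    apply FaithfulSMul.eq_of_smul_eq_smul (α := X)
    intro y
    rw [mul_smul, mul_smul]
    rcases hu y with h1 | h1 <;> rcases hw y with h2 | h2
    · rw [h1, h2, h1]
    · rw [h1, h2, key u hu, h1]
    · rw [h1, h2, h1, key w hw, h2]
    · rw [h1, h2, key u hu, key w hw, h1, h2]
  refine ⟨?_, ?_, ?_⟩
  · apply FaithfulSMul.eq_of_smul_eq_smul (α := X)
    intro y
    rw [mul_smul, mul_smul, key u h]
  · apply FaithfulSMul.eq_of_smul_eq_smul (α := X)
    intro y
    rw [mul_smul, one_smul]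
    rcases h y with h1 | h1
    · rw [h1, h1]
    · rw [h1, key u h, h1, hpp]
  · intro c hc
    apply comm u _ h
    intro y
    simp only [mul_smul]
    rcases h (c⁻¹ • y) with h1 | h1
    · left; rw [h1, smul_inv_smul]
    · right
      rw [h1, ← mul_smul c p, hc, mul_smul, smul_inv_smul]

theorem RV_sq (hG : RGood Γ X) (p g : Γ) (hp : p * p = 1) (hg : RV p g) (x : X)
    (hx : p • x ≠ x) : (g * g) • x = x := by
  by_contra hgg
  have hpp : ∀ y : X, p • p • y = y := fun y => by rw [← mul_smul, hp, one_smul]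
  have hgp' : g * p = p * g := hg p (RU_of_flip (X := X) p p hp fun y => Or.inr rfl)
  have hgp : ∀ y : X, g • p • y = p • g • y := fun y => by rw [← mul_smul, hgp', mul_smul]
  have h1 : g • x ≠ (1 : Γ) • x := fun h => hgg (by rw [one_smul] at h; rw [mul_smul, h, h])
  have h2 : g • x ≠ p • x := fun h => hgg (by rw [mul_smul, h, hgp, h, hpp])
  obtain ⟨a, ha, hxa, hda⟩ := rsep g 1 x h1
  obtain ⟨b, hb, hxb, hdb⟩ := rsep g p x h2
  obtain ⟨u, ⟨y, hy⟩, hu1, hu2⟩ := hG.flip p hp x hx (a ∩ b) (ha.inter hb) ⟨hxa, hxb⟩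
  have hgu := hg u (RU_of_flip p u hp hu2)
  have hgy : u • g • y ≠ g • y := by
    rw [← mul_smul, ← hgu, mul_smul]
    exact fun h => hy (smul_left_cancel g h)
  rcases hu1 y hy with ⟨c1, c2⟩ | ⟨c1, c2⟩ <;> rcases hu1 _ hgy with ⟨d1, d2⟩ | ⟨d1, d2⟩
  · exact hda _ c1 _ d1 (one_smul _ _).symm
  · exact hdb _ c2 _ d2 (hpp _).symm
  · exact hdb _ c2 _ d2 (hgp y)
  · exact hda _ c1 _ d1 (by rw [one_smul, hgp])

theorem RW_iff (hG : RGood Γ X) (p f : Γ) (hp : p * p = 1) :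
    RW p f ↔ RS X f ⊆ closure (RS X p) := by
  constructor
  · intro hf x hx
    by_contra hc
    obtain ⟨a, ha, hxa, hd⟩ := rsep f (1 : Γ) x (by simpa [RS] using hx)
    obtain ⟨t, ht, z, hz⟩ := hG.three (a ∩ (closure (RS X p))ᶜ)
      (ha.inter isClosed_closure.isOpen_compl) ⟨x, hxa, hc⟩
    have hV : RV p t := by
      intro u hu
      apply rcomm (X := X)
      intro y
      by_contra h
      push Not at h
      exact (ht y h.1).2 (RU_supp hG p u hu y h.2)
    have hz1 : t • z ≠ z := fun h => hz (by rw [mul_smul, h, h])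
    have hza : z ∈ a := (ht z hz1).1
    have hfz : t • f • z = f • z := by
      by_contra h
      exact hd z hza _ (ht _ h).1 (one_smul _ _).symm
    have e := congrArg (fun g : Γ => g • z) (hf t hV)
    simp only [mul_smul] at e
    rw [hfz, hfz] at e
    exact hz (by rw [mul_smul]; exact smul_left_cancel f e)
  · intro hf g hg
    apply rcomm (X := X)
    intro y
    by_cases hy : f • y = y
    · exact Or.inl hy
    · right
      have hcl : IsClosed {x : X | (g * g) • x = x} :=
        isClosed_eq (continuous_const_smul _) continuous_id
      exact closure_minimal (fun x hx => RV_sq hG p g hp hg x hx) hcl (hf hy)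

end Abstract

section Transfer

variable {Γ Δ X Y : Type*} [Group Γ] [TopologicalSpace X] [T2Space X] [MulAction Γ X]
  [ContinuousConstSMul Γ X] [FaithfulSMul Γ X]
  [Group Δ] [TopologicalSpace Y] [T2Space Y] [MulAction Δ Y]
  [ContinuousConstSMul Δ Y] [FaithfulSMul Δ Y]

theorem rinv_map (φ : Γ ≃* Δ) {p : Γ} (hp : p * p = 1) : φ p * φ p = 1 := by
  rw [← map_mul, hp, map_one]

theorem rle (hG : RGood Γ X) (hD : RGood Δ Y) (φ : Γ ≃* Δ) {p f : Γ} (hp : p * p = 1)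
    (h : RS X f ⊆ closure (RS X p)) : RS Y (φ f) ⊆ closure (RS Y (φ p)) := by
  rw [← RW_iff hD _ _ (rinv_map φ hp), RW_map, RW_iff hG _ _ hp]
  exact h

theorem rne_one {Γ X : Type*} [Group Γ] [MulAction Γ X] [FaithfulSMul Γ X] {p : Γ}
    (hp : p ≠ 1) : ∃ x : X, p • x ≠ x := by
  by_contra h
  push Not at h
  exact hp (FaithfulSMul.eq_of_smul_eq_smul (α := X) fun x => by rw [h x, one_smul])

/-- disjointness transfers -/
theorem rdisj (hG : RGood Γ X) (hD : RGood Δ Y) (φ : Γ ≃* Δ) {p q : Γ} (hp : p * p = 1)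
    (hq : q * q = 1) (h : ∀ x : X, p • x ≠ x → q • x ≠ x → False) :
    ∀ y : Y, φ p • y ≠ y → φ q • y ≠ y → False := by
  intro y h1 h2
  obtain ⟨s, hs, hsy, hsU, -⟩ := hD.inv y (RS Y (φ p) ∩ RS Y (φ q))
    ((RS_open _).inter (RS_open _)) ⟨h1, h2⟩
  have e1 := rle hD hG φ.symm (rinv_map φ hp) (f := s) fun z hz => subset_closure (hsU z hz).1
  have e2 := rle hD hG φ.symm (rinv_map φ hq) (f := s) fun z hz => subset_closure (hsU z hz).2
  rw [φ.symm_apply_apply] at e1 e2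
  obtain ⟨x, hx⟩ : ∃ x : X, φ.symm s • x ≠ x := by
    apply rne_one
    intro h1
    rw [φ.symm.map_eq_one_iff] at h1
    exact hsy (by rw [h1, one_smul])
  obtain ⟨z, hz, hz'⟩ := mem_closure_iff.1 (e1 hx) _ (RS_open _) hx
  obtain ⟨w, hw, hw'⟩ := mem_closure_iff.1 (e2 hz) _ ((RS_open (φ.symm s)).inter (RS_open p))
    ⟨hz, hz'⟩
  exact h w hw.2 hw'

def Rrel (X Y : Type*) [MulAction Γ X] [TopologicalSpace Y] [MulAction Δ Y] (φ : Γ ≃* Δ)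
    (x : X) (y : Y) : Prop :=
  ∀ p : Γ, p * p = 1 → p • x ≠ x → y ∈ closure (RS Y (φ p))

theorem Rrel_symm (hG : RGood Γ X) (hD : RGood Δ Y) (φ : Γ ≃* Δ) {x : X} {y : Y}
    (h : Rrel X Y φ x y) : Rrel Y X φ.symm y x := by
  intro s hs hsy
  by_contra hc
  obtain ⟨p, hp, hpx, hpU, -⟩ := hG.inv x _ isClosed_closure.isOpen_compl hc
  obtain ⟨z, hz, hz'⟩ := mem_closure_iff.1 (h p hp hpx) _ (RS_open s) hsy
  refine rdisj hG hD φ hp (rinv_map φ.symm hs) ?_ z hz' (by rw [φ.apply_symm_apply]; exact hz)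
  intro x h1 h2
  exact hpU x h1 (subset_closure h2)

theorem Rrel_unique (hG : RGood Γ X) (hD : RGood Δ Y) (φ : Γ ≃* Δ) {x : X} {y₁ y₂ : Y}
    (h₁ : Rrel X Y φ x y₁) (h₂ : Rrel X Y φ x y₂) : y₁ = y₂ := by
  by_contra hne
  obtain ⟨U, U', hU, hU', hy1, hy2, hd⟩ := t2_separation hne
  obtain ⟨s, hs, hsy, hsU, A, hA, hyA, hv⟩ := hD.inv y₁ U hU hy1
  have hy2s : y₂ ∉ closure (RS Y s) := by
    intro h
    obtain ⟨z, hz, hz'⟩ := mem_closure_iff.1 h U' hU' hy2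
    exact Set.disjoint_left.1 hd (hsU z hz') hz
  have hps := rinv_map φ.symm hs
  set p := φ.symm s with hpdef
  have hφp : φ p = s := φ.apply_symm_apply s
  -- x is not in the interior of the closure
  have hxint : x ∉ interior (closure (RS X p)) := by
    intro hx
    obtain ⟨q, hq, hqx, hqU, -⟩ := hG.inv x _ isOpen_interior hx
    have := rle hG hD φ hps (f := q) fun z hz => interior_subset (hqU z hz)
    rw [hφp] at this
    exact hy2s (closure_minimal this isClosed_closure (h₂ q hq hqx))
  have hpint : RS X p ⊆ interior (closure (RS X p)) := interior_maximal subset_closure (RS_open p)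
  obtain ⟨b, hb⟩ : ∃ b : X, p • b ≠ b := by
    apply rne_one
    intro h1
    rw [h1, map_one] at hφp
    exact hsy (by rw [← hφp, one_smul])
  have hbx : b ≠ x := by
    rintro rfl
    exact hxint (hpint hb)
  obtain ⟨C, C', hC, hC', hbC, hxC', hCd⟩ := t2_separation hbx
  obtain ⟨r, hr, hrb, hrU, -⟩ := hG.inv b (C ∩ RS X p) (hC.inter (RS_open p)) ⟨hbC, hb⟩
  have hrs := rle hG hD φ hps (f := r) fun z hz => subset_closure (hrU z hz).2
  rw [hφp] at hrs
  obtain ⟨y, hy⟩ : ∃ y : Y, φ r • y ≠ y := by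
    apply rne_one
    intro h1
    rw [φ.map_eq_one_iff] at h1
    exact hrb (by rw [h1, one_smul])
  obtain ⟨z, hz, hz'⟩ := mem_closure_iff.1 (hrs hy) _ (RS_open _) hy
  obtain ⟨v, hvs, hvA⟩ := hv _ (RS_open (φ r)) z hz hz'
  obtain ⟨t, ht, hty, htA, -⟩ := hD.inv y₁ A hA hyA
  have hxt : x ∈ closure (RS X (φ.symm t)) := Rrel_symm hG hD φ h₁ t ht hty
  have hvx : φ.symm v • x = x := by
    by_contra hc
    have := rle hD hG φ.symm hs (f := v) fun w hw => subset_closure (hvs w hw)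
    exact hxint (interior_maximal this (RS_open _) hc)
  have hle := rle hD hG φ.symm (rinv_map φ hr) (f := v * t * v⁻¹) (by
    intro w hw
    apply subset_closure
    have : t • v⁻¹ • w ≠ v⁻¹ • w := by
      intro h
      apply hw
      rw [mul_smul, mul_smul, h, smul_inv_smul]
    have := hvA _ (htA _ this)
    rwa [smul_inv_smul] at this)
  rw [φ.symm_apply_apply] at hle
  have hx1 : x ∈ closure (RS X (φ.symm (v * t * v⁻¹))) := by
    have h3 : φ.symm v • x ∈ closure ((φ.symm v • ·) '' RS X (φ.symm t)) :=
      image_closure_subset_closure_image (continuous_const_smul _) ⟨x, hxt, rfl⟩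
    rw [hvx] at h3
    refine closure_mono ?_ h3
    rintro _ ⟨w, hw, rfl⟩ h4
    apply hw
    simp only [map_mul, map_inv, mul_smul, inv_smul_smul] at h4
    exact smul_left_cancel _ h4
  have hx2 : x ∈ closure (RS X r) := closure_minimal hle isClosed_closure hx1
  obtain ⟨w, hw, hw'⟩ := mem_closure_iff.1 hx2 C' hC' hxC'
  exact Set.disjoint_left.1 hCd (hrU w hw').1 hw

theorem Rrel_exists [CompactSpace Y] (hG : RGood Γ X) (hD : RGood Δ Y) (φ : Γ ≃* Δ) (x : X) :
    ∃ y : Y, Rrel X Y φ x y := by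
  let ι := {p : Γ // p * p = 1 ∧ p • x ≠ x}
  obtain ⟨s, hs, hsx, -⟩ := hG.inv x Set.univ isOpen_univ trivial
  have : Nonempty ι := ⟨⟨s, hs, hsx⟩⟩
  have := IsCompact.nonempty_iInter_of_directed_nonempty_isCompact_isClosed
    (fun i : ι => closure (RS Y (φ i.1))) ?_ ?_ (fun i => isClosed_closure.isCompact)
    (fun i => isClosed_closure)
  · obtain ⟨y, hy⟩ := this
    exact ⟨y, fun p hp hpx => Set.mem_iInter.1 hy ⟨p, hp, hpx⟩⟩
  · rintro ⟨p, hp, hpx⟩ ⟨q, hq, hqx⟩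
    obtain ⟨s, hs, hsx, hsU, -⟩ := hG.inv x (RS X p ∩ RS X q)
      ((RS_open _).inter (RS_open _)) ⟨hpx, hqx⟩
    refine ⟨⟨s, hs, hsx⟩, ?_, ?_⟩
    · exact closure_minimal (rle hG hD φ hp fun z hz => subset_closure (hsU z hz).1)
        isClosed_closure
    · exact closure_minimal (rle hG hD φ hq fun z hz => subset_closure (hsU z hz).2)
        isClosed_closure
  · rintro ⟨p, hp, hpx⟩
    obtain ⟨y, hy⟩ : ∃ y : Y, φ p • y ≠ y := by
      apply rne_one
      intro h1
      rw [φ.map_eq_one_iff] at h1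
      exact hpx (by rw [h1, one_smul])
    exact ⟨y, subset_closure hy⟩

theorem Rrel_smul (φ : Γ ≃* Δ) {x : X} {y : Y} (h : Rrel X Y φ x y) (v : Γ) :
    Rrel X Y φ (v • x) (φ v • y) := by
  intro p hp hpx
  have h1 := h (v⁻¹ * p * v) (by
      have : v⁻¹ * p * v * (v⁻¹ * p * v) = v⁻¹ * (p * p) * v := by group
      rw [this, hp]; group) (by
    intro h2
    apply hpx
    rwa [mul_smul, mul_smul, inv_smul_eq_iff] at h2)
  have h3 : φ v • y ∈ closure ((φ v • ·) '' RS Y (φ (v⁻¹ * p * v))) :=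
    image_closure_subset_closure_image (continuous_const_smul _) ⟨y, h1, rfl⟩
  refine closure_mono ?_ h3
  rintro _ ⟨w, hw, rfl⟩ h4
  apply hw
  simp only [map_mul, map_inv, mul_smul]
  rw [inv_smul_eq_iff]
  exact h4

theorem rubin_abs [CompactSpace X] [CompactSpace Y] (hG : RGood Γ X) (hD : RGood Δ Y)
    (φ : Γ ≃* Δ) : ∃! ψ : X ≃ₜ Y, ∀ v : Γ, ∀ y : Y, φ v • y = ψ (v • ψ.symm y) := by
  choose f hf using Rrel_exists hG hD φ
  choose g hg using Rrel_exists hD hG φ.symm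
  have hgf : ∀ x, g (f x) = x := fun x =>
    Rrel_unique hD hG φ.symm (hg (f x)) (Rrel_symm hG hD φ (hf x))
  have hfg : ∀ y, f (g y) = y := fun y =>
    Rrel_unique hG hD φ (hf (g y)) (by simpa using Rrel_symm hD hG φ.symm (hg y))
  have hcont : Continuous f := by
    have hR : IsClosed {q : X × Y | Rrel X Y φ q.1 q.2} := by
      have : {q : X × Y | Rrel X Y φ q.1 q.2} = ⋂ p : Γ, ⋂ _ : p * p = 1,
          ({q : X × Y | p • q.1 = q.1} ∪ {q : X × Y | q.2 ∈ closure (RS Y (φ p))}) := by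
        ext q
        simp only [Rrel, Set.mem_setOf_eq, Set.mem_iInter, Set.mem_union]
        refine forall₂_congr fun p hp => ?_
        tauto
      rw [this]
      refine isClosed_iInter fun p => isClosed_iInter fun _ => IsClosed.union ?_ ?_
      · exact isClosed_eq ((continuous_const_smul p).comp continuous_fst) continuous_fst
      · exact isClosed_closure.preimage continuous_snd
    rw [continuous_iff_isClosed]
    intro F hF
    have : f ⁻¹' F = Prod.fst '' ({q : X × Y | Rrel X Y φ q.1 q.2} ∩ Prod.snd ⁻¹' F) := by
      ext x
      constructor
      · intro hx
        exact ⟨(x, f x), ⟨hf x, hx⟩, rfl⟩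
      · rintro ⟨⟨x', y⟩, ⟨h1, h2⟩, rfl⟩
        have := Rrel_unique hG hD φ (hf x') h1
        change f x' ∈ F
        rw [this]
        exact h2
    rw [this]
    exact isClosedMap_fst_of_compactSpace _ (hR.inter (hF.preimage continuous_snd))
  let e : X ≃ Y := ⟨f, g, hgf, hfg⟩
  have he : Continuous e := hcont
  refine ⟨he.homeoOfEquivCompactToT2, ?_, ?_⟩
  · intro v y
    change φ v • y = f (v • g y)
    refine Rrel_unique hG hD φ (x := v • g y) ?_ (hf _)
    have := Rrel_smul φ (hf (g y)) v
    rwa [hfg] at this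
  · intro ψ hψ
    ext x
    change ψ x = f x
    refine Rrel_unique hG hD φ ?_ (hf x)
    intro p hp hpx
    apply subset_closure
    intro h
    rw [hψ, ψ.symm_apply_apply] at h
    exact hpx (ψ.injective h)

end Transfer
section CantorSide

variable {n : ℕ}

/-- the cone of sequences agreeing with `p` below `k` -/
def RC (p : Cantor n) (k : ℕ) : Set (Cantor n) := {y | ∀ i < k, y i = p i}

def rsplice (q : Cantor n) (l : ℕ) (z : Cantor n) : Cantor n :=
  fun i => if i < l then q i else z (i - l)

def rpre (p : Cantor n) (k : ℕ) : List (Fin n) := List.ofFn fun i : Fin k => p i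

theorem rpre_length (p : Cantor n) (k : ℕ) : (rpre p k).length = k := by simp [rpre]

theorem inCone_rpre (p : Cantor n) (k : ℕ) (y : Cantor n) : inCone (rpre p k) y ↔ y ∈ RC p k := by
  unfold inCone RC rpre
  simp

theorem append_rpre (p : Cantor n) (k : ℕ) (y : Cantor n) :
    appendWord (rpre p k) y = rsplice p k y := by
  funext i
  unfold appendWord rsplice rpre
  simp

theorem exists_rpre (hn : 0 < n) (w : List (Fin n)) : ∃ p : Cantor n, w = rpre p w.length := by
  refine ⟨fun i => if h : i < w.length then w.get ⟨i, h⟩ else ⟨0, hn⟩, ?_⟩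
  apply List.ext_getElem
  · simp [rpre]
  · intro i h1 h2
    simp [rpre, h1]

theorem rsplice_mem (q : Cantor n) (l : ℕ) (z : Cantor n) : rsplice q l z ∈ RC q l := by
  intro i hi
  simp [rsplice, hi]

theorem rsplice_shift (q : Cantor n) (l : ℕ) (y : Cantor n) (h : y ∈ RC q l) :
    rsplice q l (fun i => y (l + i)) = y := by
  funext i
  unfold rsplice
  split_ifs with hi
  · exact (h i hi).symm
  · change y (l + (i - l)) = y i
    rw [Nat.add_sub_cancel' (not_lt.1 hi)]

theorem rsplice_apply (q : Cantor n) (l : ℕ) (z : Cantor n) (i : ℕ) : rsplice q l z (l + i) = z i := by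
  simp [rsplice]

theorem RC_clopen (p : Cantor n) (k : ℕ) : IsClopen (RC p k) := by
  have : RC p k = ⋂ i ∈ Finset.range k, (fun y : Cantor n => y i) ⁻¹' {p i} := by
    ext y; simp [RC]
  rw [this]
  exact isClopen_biInter_finset fun i _ => (isClopen_discrete _).preimage (continuous_apply i)

theorem RC_basis (U : Set (Cantor n)) (hU : IsOpen U) (x : Cantor n) (hx : x ∈ U) :
    ∃ N, ∀ k ≥ N, RC x k ⊆ U := by
  obtain ⟨I, u, hu, hs⟩ := isOpen_pi_iff.1 hU x hx
  refine ⟨I.sup id + 1, fun k hk y hy => hs ?_⟩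
  intro i hi
  have : i ≤ I.sup id := Finset.le_sup (f := id) hi
  rw [hy i (by omega)]
  exact (hu i hi).2

theorem RC_sub (p : Cantor n) {k l : ℕ} (h : k ≤ l) (q : Cantor n) (hq : q ∈ RC p k) :
    RC q l ⊆ RC p k := fun y hy i hi => (hy i (by omega)).trans (hq i hi)

/-! swap -/

noncomputable def rswapFun (p : Cantor n) (k : ℕ) (q : Cantor n) (l : ℕ) (y : Cantor n) : Cantor n :=
  if y ∈ RC p k then rsplice q l (fun i => y (k + i)) else
    if y ∈ RC q l then rsplice p k (fun i => y (l + i)) else y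

theorem rswap_cont (p : Cantor n) (k : ℕ) (q : Cantor n) (l : ℕ) :
    Continuous (rswapFun p k q l) := by
  have hs : ∀ (q : Cantor n) (l k : ℕ),
      Continuous fun y : Cantor n => rsplice q l (fun i => y (k + i)) := by
    intro q l k
    apply continuous_pi
    intro i
    unfold rsplice
    split_ifs <;> fun_prop
  unfold rswapFun
  apply Continuous.if
  · intro a ha
    have : frontier (RC p k) = ∅ := (RC_clopen p k).frontier_eq
    exact absurd (this ▸ ha : a ∈ (∅ : Set (Cantor n))) (Set.notMem_empty _)
  · exact hs _ _ _
  · apply Continuous.if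
    · intro a ha
      have : frontier (RC q l) = ∅ := (RC_clopen q l).frontier_eq
      exact absurd (this ▸ ha : a ∈ (∅ : Set (Cantor n))) (Set.notMem_empty _)
    · exact hs _ _ _
    · exact continuous_id

theorem rswap_invol (p : Cantor n) (k : ℕ) (q : Cantor n) (l : ℕ)
    (hd : Disjoint (RC p k) (RC q l)) (y : Cantor n) :
    rswapFun p k q l (rswapFun p k q l y) = y := by
  by_cases h1 : y ∈ RC p k
  · have e : rswapFun p k q l y = rsplice q l (fun i => y (k + i)) := by simp [rswapFun, h1]
    have h2 := rsplice_mem q l (fun i => y (k + i))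
    have h3 := Set.disjoint_right.1 hd h2
    rw [e, rswapFun, if_neg h3, if_pos h2]
    simp only [rsplice_apply]
    exact rsplice_shift p k y h1
  · by_cases h2 : y ∈ RC q l
    · have e : rswapFun p k q l y = rsplice p k (fun i => y (l + i)) := by simp [rswapFun, h1, h2]
      have h3 := rsplice_mem p k (fun i => y (l + i))
      rw [e, rswapFun, if_pos h3]
      simp only [rsplice_apply]
      exact rsplice_shift q l y h2
    · have e : rswapFun p k q l y = y := by simp [rswapFun, h1, h2]
      rw [e, e]

noncomputable def rswap (p : Cantor n) (k : ℕ) (q : Cantor n) (l : ℕ)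
    (hd : Disjoint (RC p k) (RC q l)) : Cantor n ≃ₜ Cantor n where
  toFun := rswapFun p k q l
  invFun := rswapFun p k q l
  left_inv := rswap_invol p k q l hd
  right_inv := rswap_invol p k q l hd
  continuous_toFun := rswap_cont p k q l
  continuous_invFun := rswap_cont p k q l

theorem isPrefix_of_finite {ι : Type*} [Finite ι] (v : Cantor n → Cantor n)
    (α β : ι → List (Fin n)) (h1 : ∀ x : Cantor n, ∃! i, inCone (α i) x)
    (h2 : ∀ x : Cantor n, ∃! i, inCone (β i) x)
    (h3 : ∀ i γ, v (appendWord (α i) γ) = appendWord (β i) γ) : IsPrefixMap v := by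
  obtain ⟨t, ⟨e⟩⟩ := Finite.exists_equiv_fin ι
  refine ⟨t, α ∘ e.symm, β ∘ e.symm, ?_, ?_, fun i γ => h3 _ _⟩
  · intro x
    exact (e.symm.bijective.existsUnique_iff (p := fun i => inCone (α i) x)).1 (h1 x)
  · intro x
    exact (e.symm.bijective.existsUnique_iff (p := fun i => inCone (β i) x)).1 (h2 x)

theorem rswap_prefix (p : Cantor n) (k : ℕ) (q : Cantor n) (l : ℕ)
    (hd : Disjoint (RC p k) (RC q l)) : IsPrefixMap (rswapFun p k q l) := by
  let T := {w : List (Fin n) // w.length = max k l ∧ ∀ x, inCone w x → x ∉ RC p k ∧ x ∉ RC q l}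
  have : Finite T := by
    have : Finite {w : List (Fin n) // w.length = max k l} :=
      (List.finite_length_eq (Fin n) (max k l)).to_subtype
    exact Finite.of_injective
      (fun w : T => (⟨w.1, w.2.1⟩ : {w : List (Fin n) // w.length = max k l}))
      (fun a b h => Subtype.ext (Subtype.mk.inj h))
  have hT : ∀ x : Cantor n, x ∉ RC p k → x ∉ RC q l → ∃ w : T, inCone w.1 x := by
    intro x h1 h2
    refine ⟨⟨rpre x (max k l), rpre_length _ _, ?_⟩, ?_⟩
    · intro y hy
      rw [inCone_rpre] at hy
      constructor
      · intro h
        exact h1 fun i hi => by rw [← h i hi, hy i (lt_max_of_lt_left hi)]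
      · intro h
        exact h2 fun i hi => by rw [← h i hi, hy i (lt_max_of_lt_right hi)]
    · rw [inCone_rpre]
      intro i _
      rfl
  have hTu : ∀ x : Cantor n, ∀ w w' : T, inCone w.1 x → inCone w'.1 x → w = w' := by
    rintro x ⟨w, hw, _⟩ ⟨w', hw', _⟩ h h'
    apply Subtype.ext
    apply List.ext_getElem
    · exact hw.trans hw'.symm
    · intro i h1 h2
      have a1 := h i h1
      have a2 := h' i h2
      exact a1.symm.trans a2
  let α : Option (Option T) → List (Fin n) := fun o => match o with
    | none => rpre p k
    | some none => rpre q l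
    | some (some w) => w.1
  let β : Option (Option T) → List (Fin n) := fun o => match o with
    | none => rpre q l
    | some none => rpre p k
    | some (some w) => w.1
  have hpq : ∀ x, x ∈ RC p k → x ∈ RC q l → False := fun x h h' => Set.disjoint_left.1 hd h h'
  refine isPrefix_of_finite _ α β ?_ ?_ ?_
  · intro x
    by_cases h1 : x ∈ RC p k
    · refine ⟨none, (inCone_rpre _ _ _).2 h1, ?_⟩
      rintro (_ | _ | w) h
      · rfl
      · exact (hpq x h1 ((inCone_rpre _ _ _).1 h)).elim
      · exact ((w.2.2 x h).1 h1).elim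
    by_cases h2 : x ∈ RC q l
    · refine ⟨some none, (inCone_rpre _ _ _).2 h2, ?_⟩
      rintro (_ | _ | w) h
      · exact (hpq x ((inCone_rpre _ _ _).1 h) h2).elim
      · rfl
      · exact ((w.2.2 x h).2 h2).elim
    obtain ⟨w, hw⟩ := hT x h1 h2
    refine ⟨some (some w), hw, ?_⟩
    rintro (_ | _ | w') h
    · exact (h1 ((inCone_rpre _ _ _).1 h)).elim
    · exact (h2 ((inCone_rpre _ _ _).1 h)).elim
    · rw [hTu x w w' hw h]
  · intro x
    by_cases h1 : x ∈ RC p k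
    · refine ⟨some none, (inCone_rpre _ _ _).2 h1, ?_⟩
      rintro (_ | _ | w) h
      · exact (hpq x h1 ((inCone_rpre _ _ _).1 h)).elim
      · rfl
      · exact ((w.2.2 x h).1 h1).elim
    by_cases h2 : x ∈ RC q l
    · refine ⟨none, (inCone_rpre _ _ _).2 h2, ?_⟩
      rintro (_ | _ | w) h
      · rfl
      · exact (hpq x ((inCone_rpre _ _ _).1 h) h2).elim
      · exact ((w.2.2 x h).2 h2).elim
    obtain ⟨w, hw⟩ := hT x h1 h2
    refine ⟨some (some w), hw, ?_⟩
    rintro (_ | _ | w') h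
    · exact (h2 ((inCone_rpre _ _ _).1 h)).elim
    · exact (h1 ((inCone_rpre _ _ _).1 h)).elim
    · rw [hTu x w w' hw h]
  · rintro (_ | _ | w) γ
    · change rswapFun p k q l (appendWord (rpre p k) γ) = appendWord (rpre q l) γ
      rw [append_rpre, append_rpre, rswapFun, if_pos (rsplice_mem _ _ _)]
      simp only [rsplice_apply]
    · change rswapFun p k q l (appendWord (rpre q l) γ) = appendWord (rpre p k) γ
      rw [append_rpre, append_rpre, rswapFun, if_neg (fun h => hpq _ h (rsplice_mem _ _ _)),
        if_pos (rsplice_mem _ _ _)]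
      simp only [rsplice_apply]
    · change rswapFun p k q l (appendWord w.1 γ) = appendWord w.1 γ
      have : inCone w.1 (appendWord w.1 γ) := by
        intro i hi
        simp [appendWord, hi]
      have := w.2.2 _ this
      rw [rswapFun, if_neg this.1, if_neg this.2]

/-! iterated permutations -/

theorem riter_apply (q : Cantor n) (l : ℕ) (g : Equiv.Perm (Fin n)) (y : Cantor n) (h : y ∈ RC q l) :
    iterPermFun (rpre q l) g y = fun i => if i < l then y i else g (y i) := by
  rw [iterPermFun, if_pos ((inCone_rpre _ _ _).2 h), rpre_length]

theorem riter_apply' (q : Cantor n) (l : ℕ) (g : Equiv.Perm (Fin n)) (y : Cantor n) (h : y ∉ RC q l) :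
    iterPermFun (rpre q l) g y = y := by
  rw [iterPermFun, if_neg (fun h' => h ((inCone_rpre _ _ _).1 h'))]

theorem riter_inv (q : Cantor n) (l : ℕ) (g g' : Equiv.Perm (Fin n)) (hg : g' * g = 1) (y : Cantor n) :
    iterPermFun (rpre q l) g' (iterPermFun (rpre q l) g y) = y := by
  by_cases h : y ∈ RC q l
  · have h2 : (fun i => if i < l then y i else g (y i)) ∈ RC q l := by
      intro i hi
      simp only [hi, if_true]
      exact h i hi
    rw [riter_apply q l g y h, riter_apply q l g' _ h2]
    funext i
    by_cases hi : i < l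
    · simp [hi]
    · simp only [hi, if_false]
      rw [← Equiv.Perm.mul_apply, hg, Equiv.Perm.one_apply]
  · rw [riter_apply' q l g y h, riter_apply' q l g' y h]

theorem riter_cont (q : Cantor n) (l : ℕ) (g : Equiv.Perm (Fin n)) :
    Continuous (iterPermFun (rpre q l) g) := by
  have e : iterPermFun (rpre q l) g =
      fun y => if y ∈ RC q l then (fun i => if i < l then y i else g (y i)) else y := by
    funext y
    by_cases h : y ∈ RC q l
    · rw [riter_apply q l g y h, if_pos h]
    · rw [riter_apply' q l g y h, if_neg h]
  rw [e]
  apply Continuous.if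
  · intro a ha
    have : frontier (RC q l) = ∅ := (RC_clopen q l).frontier_eq
    exact absurd (this ▸ ha : a ∈ (∅ : Set (Cantor n))) (Set.notMem_empty _)
  · apply continuous_pi
    intro i
    split_ifs
    · fun_prop
    · exact (continuous_of_discreteTopology (f := g)).comp (continuous_apply i)
  · exact continuous_id

noncomputable def riter (q : Cantor n) (l : ℕ) (g : Equiv.Perm (Fin n)) : Cantor n ≃ₜ Cantor n where
  toFun := iterPermFun (rpre q l) g
  invFun := iterPermFun (rpre q l) g⁻¹
  left_inv := riter_inv q l g g⁻¹ (by simp)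
  right_inv := riter_inv q l g⁻¹ g (by simp)
  continuous_toFun := riter_cont q l g
  continuous_invFun := riter_cont q l g⁻¹

/-! the group acts -/

variable (G : Subgroup (Equiv.Perm (Fin n)))

instance rAct : MulAction (VnG n G) (Cantor n) where
  smul v x := (v : Cantor n ≃ₜ Cantor n) x
  one_smul _ := rfl
  mul_smul _ _ _ := rfl

theorem rsmul_def (v : VnG n G) (x : Cantor n) : v • x = (v : Cantor n ≃ₜ Cantor n) x := rfl

instance : ContinuousConstSMul (VnG n G) (Cantor n) :=
  ⟨fun v => (v : Cantor n ≃ₜ Cantor n).continuous⟩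

instance : FaithfulSMul (VnG n G) (Cantor n) :=
  ⟨fun h => Subtype.ext (Homeomorph.ext h)⟩

theorem rswap_exists (p : Cantor n) (k : ℕ) (q : Cantor n) (l : ℕ)
    (hd : Disjoint (RC p k) (RC q l)) : ∃ u : VnG n G, ∀ y : Cantor n, u • y = rswapFun p k q l y :=
  ⟨⟨rswap p k q l hd, Subgroup.subset_closure (Or.inl (rswap_prefix p k q l hd))⟩, fun _ => rfl⟩

theorem riter_exists (q : Cantor n) (l : ℕ) (g : Equiv.Perm (Fin n)) (hg : g ∈ G) :
    ∃ u : VnG n G, (∀ y : Cantor n, u • y = iterPermFun (rpre q l) g y) ∧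
      (∀ y : Cantor n, u⁻¹ • y = iterPermFun (rpre q l) g⁻¹ y) :=
  ⟨⟨riter q l g, Subgroup.subset_closure (Or.inr ⟨_, g, hg, rfl⟩)⟩, fun _ => rfl, fun _ => rfl⟩

/-- plain swaps -/
theorem rsw (p : Cantor n) (k : ℕ) (q : Cantor n) (l : ℕ)
    (hd : Disjoint (RC p k) (RC q l)) : ∃ u : VnG n G, u * u = 1 ∧ (∀ y ∈ RC p k, u • y ∈ RC q l) ∧
      (∀ y ∈ RC q l, u • y ∈ RC p k) ∧ ∀ y, y ∉ RC p k → y ∉ RC q l → u • y = y := by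
  obtain ⟨u, hu⟩ := rswap_exists G p k q l hd
  refine ⟨u, ?_, ?_, ?_, ?_⟩
  · apply FaithfulSMul.eq_of_smul_eq_smul (α := Cantor n)
    intro y
    rw [mul_smul, hu, hu, rswap_invol p k q l hd, one_smul]
  · intro y hy
    rw [hu, rswapFun, if_pos hy]
    exact rsplice_mem _ _ _
  · intro y hy
    rw [hu, rswapFun, if_neg (Set.disjoint_right.1 hd hy), if_pos hy]
    exact rsplice_mem _ _ _
  · intro y h1 h2
    rw [hu, rswapFun, if_neg h1, if_neg h2]

/-- twisted swaps -/
theorem rtw (p : Cantor n) (k : ℕ) (q : Cantor n) (l : ℕ)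
    (hd : Disjoint (RC p k) (RC q l)) (g : Equiv.Perm (Fin n)) (hg : g ∈ G) :
    ∃ u : VnG n G, (∀ y ∈ RC p k, u • y = rsplice q l (fun i => g (y (k + i)))) ∧
      (∀ y ∈ RC q l, u • y = rsplice p k (fun i => g⁻¹ (y (l + i)))) ∧
      ∀ y, y ∉ RC p k → y ∉ RC q l → u • y = y := by
  obtain ⟨s, hs⟩ := rswap_exists G p k q l hd
  obtain ⟨r, hr, hr'⟩ := riter_exists G q l g hg
  refine ⟨r * s * r⁻¹, ?_, ?_, ?_⟩
  · intro y hy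
    rw [mul_smul, mul_smul, hr', riter_apply' q l _ y (Set.disjoint_left.1 hd hy), hs,
      rswapFun, if_pos hy, hr, riter_apply q l g _ (rsplice_mem _ _ _)]
    funext i
    unfold rsplice
    split_ifs <;> simp_all
  · intro y hy
    have h2 : (fun i => if i < l then y i else g⁻¹ (y i)) ∈ RC q l := by
      intro i hi
      simp only [hi, if_true]
      exact hy i hi
    rw [mul_smul, mul_smul, hr', riter_apply q l _ y hy, hs,
      rswapFun, if_neg (Set.disjoint_right.1 hd h2), if_pos h2, hr,
      riter_apply' q l g _ (Set.disjoint_left.1 hd (rsplice_mem _ _ _))]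
    funext i
    unfold rsplice
    split_ifs <;> simp_all
  · intro y h1 h2
    rw [mul_smul, mul_smul, hr', riter_apply' q l _ y h2, hs, rswapFun, if_neg h1, if_neg h2,
      hr, riter_apply' q l _ y h2]

/-! local structure -/

def RLoc (v : Cantor n ≃ₜ Cantor n) : Prop :=
  ∀ x : Cantor n, ∃ k l : ℕ, ∃ g ∈ G, ∀ y ∈ RC x k, v y ∈ RC (v x) l ∧ ∀ i, v y (l + i) = g (y (k + i))

theorem RLoc_up {v : Cantor n ≃ₜ Cantor n} {x : Cantor n} {k l : ℕ} {g : Equiv.Perm (Fin n)}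
    (h : ∀ y ∈ RC x k, v y ∈ RC (v x) l ∧ ∀ i, v y (l + i) = g (y (k + i))) (j : ℕ) :
    ∀ y ∈ RC x (k + j), v y ∈ RC (v x) (l + j) ∧ ∀ i, v y (l + j + i) = g (y (k + j + i)) := by
  intro y hy
  have h1 := h y fun i hi => hy i (by omega)
  have h2 := h x fun i hi => rfl
  refine ⟨?_, fun i => ?_⟩
  · intro i hi
    by_cases hil : i < l
    · exact h1.1 i hil
    · obtain ⟨d, rfl⟩ := Nat.exists_eq_add_of_le (not_lt.1 hil)
      rw [h1.2, h2.2, hy _ (by omega)]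
  · rw [add_assoc, h1.2, add_assoc]

theorem RLoc_all (v : Cantor n ≃ₜ Cantor n) (hv : v ∈ VnG n G) : RLoc G v := by
  unfold VnG at hv
  induction hv using Subgroup.closure_induction with
  | mem v hv =>
    intro x
    rcases hv with ⟨t, α, β, hα, hβ, h⟩ | ⟨α, g, hg, h⟩
    · obtain ⟨i, hi, -⟩ := hα x
      have hn : 0 < n := (x 0).pos
      obtain ⟨p, hp⟩ := exists_rpre hn (α i)
      obtain ⟨q, hq⟩ := exists_rpre hn (β i)
      have h' := h i
      rw [hp] at hi h'
      rw [hq] at h'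
      simp only [append_rpre, inCone_rpre] at hi h'
      have key : ∀ y ∈ RC p (α i).length, v y = rsplice q (β i).length
          (fun j => y ((α i).length + j)) := by
        intro y hy
        rw [← h', rsplice_shift _ _ _ hy]
      refine ⟨(α i).length, (β i).length, 1, G.one_mem, fun y hy => ?_⟩
      have hy' := RC_sub p le_rfl x hi hy
      rw [key y hy', key x hi]
      refine ⟨?_, fun j => rsplice_apply _ _ _ _⟩
      intro j hj
      simp [rsplice, hj]
    · have hn : 0 < n := (x 0).pos
      obtain ⟨p, hp⟩ := exists_rpre hn α
      rw [hp] at h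
      by_cases hx : x ∈ RC p α.length
      · refine ⟨α.length, α.length, g, hg, fun y hy => ?_⟩
        have hy' := RC_sub p le_rfl x hx hy
        rw [h, riter_apply _ _ _ _ hx, riter_apply _ _ _ _ hy']
        refine ⟨?_, fun j => by simp⟩
        intro j hj
        simp only [hj, if_true]
        exact hy j hj
      · refine ⟨α.length, α.length, 1, G.one_mem, fun y hy => ?_⟩
        have hy' : y ∉ RC p α.length := fun h => hx fun i hi => by rw [← h i hi, hy i hi]
        rw [h, riter_apply' _ _ _ _ hx, riter_apply' _ _ _ _ hy']
        exact ⟨hy, fun j => rfl⟩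
  | one => exact fun x => ⟨0, 0, 1, G.one_mem, fun y hy => ⟨hy, fun i => rfl⟩⟩
  | mul w v _ _ hw hv =>
    intro x
    obtain ⟨k, l, g, hg, h⟩ := hv x
    obtain ⟨k', l', g', hg', h'⟩ := hw (v x)
    refine ⟨k + k', l' + l, g' * g, G.mul_mem hg' hg, fun y hy => ?_⟩
    have h1 := RLoc_up h k' y hy
    have h2 := RLoc_up h' l (v y) (by rw [add_comm]; exact h1.1)
    refine ⟨h2.1, fun i => ?_⟩
    change w (v y) (l' + l + i) = g' (g (y (k + k' + i)))
    rw [h2.2, add_comm k' l, h1.2]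
  | inv v _ hv =>
    intro x'
    obtain ⟨x, rfl⟩ := v.surjective x'
    obtain ⟨k, l, g, hg, h⟩ := hv x
    refine ⟨l, k, g⁻¹, G.inv_mem hg, fun y hy => ?_⟩
    change v.symm y ∈ RC (v.symm (v x)) k ∧ ∀ i, v.symm y (k + i) = g⁻¹ (y (l + i))
    have e : v.symm y = rsplice x k (fun i => g⁻¹ (y (l + i))) := by
      rw [Homeomorph.symm_apply_eq]
      have h1 := h _ (rsplice_mem x k (fun i => g⁻¹ (y (l + i))))
      funext i
      by_cases hi : i < l
      · rw [hy i hi, h1.1 i hi]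
      · obtain ⟨d, rfl⟩ := Nat.exists_eq_add_of_le (not_lt.1 hi)
        rw [h1.2, rsplice_apply]
        simp
    rw [e, v.symm_apply_apply]
    exact ⟨rsplice_mem _ _ _, fun i => rsplice_apply _ _ _ _⟩

theorem RC_disj {p q : Cantor n} {k l i : ℕ} (hk : i < k) (hl : i < l) (h : p i ≠ q i) :
    Disjoint (RC p k) (RC q l) := by
  rw [Set.disjoint_left]
  intro y h1 h2
  exact h ((h1 i hk).symm.trans (h2 i hl))

theorem RC_self (p : Cantor n) (k : ℕ) : p ∈ RC p k := fun _ _ => rfl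

theorem rother (hn : 2 ≤ n) (a : Fin n) : ∃ b : Fin n, b ≠ a := by
  have : Nontrivial (Fin n) := Fin.nontrivial_iff_two_le.2 hn
  exact exists_ne a

theorem VnG_good (hn : 2 ≤ n) : RGood (VnG n G) (Cantor n) where
  flip := by
    intro p hp x hx a ha hxa
    have hpp : ∀ y : Cantor n, p • p • y = y := fun y => by rw [← mul_smul, hp, one_smul]
    obtain ⟨k, l, g, hg, h⟩ := RLoc_all G p.1 p.2 x
    obtain ⟨N, hN⟩ := RC_basis a ha x hxa
    obtain ⟨i, hi⟩ := Function.ne_iff.1 hx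
    have h' := RLoc_up h (N + i + 1)
    have hNk := hN (k + (N + i + 1)) (by omega)
    have hd : Disjoint (RC x (k + (N + i + 1))) (RC (p • x) (l + (N + i + 1))) :=
      RC_disj (i := i) (by omega) (by omega) hi.symm
    generalize k + (N + i + 1) = K at *
    generalize l + (N + i + 1) = L at *
    change ∀ y ∈ RC x K, p • y ∈ RC (p • x) L ∧ ∀ i, (p • y) (L + i) = g (y (K + i)) at h'
    obtain ⟨u, hu1, hu2, hu3⟩ := rtw G x K (p • x) L hd g hg
    have e1 : ∀ y ∈ RC x K, u • y = p • y := by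
      intro y hy
      obtain ⟨h1, h2⟩ := h' y hy
      rw [hu1 y hy, ← rsplice_shift _ _ _ h1]
      simp only [h2]
    have e2 : ∀ y ∈ RC (p • x) L, u • y ∈ RC x K ∧ u • y = p • y := by
      intro y hy
      have hm : u • y ∈ RC x K := by rw [hu2 y hy]; exact rsplice_mem _ _ _
      refine ⟨hm, ?_⟩
      have : p • (u • y) = y := by
        obtain ⟨h1, h2⟩ := h' _ hm
        refine (rsplice_shift _ _ _ h1).symm.trans (Eq.trans ?_ (rsplice_shift _ _ _ hy))
        congr 1
        funext j
        rw [h2, hu2 y hy, rsplice_apply]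
        simp
      rw [← hpp (u • y), this]
    refine ⟨u, ⟨x, ?_⟩, ?_, ?_⟩
    · rw [e1 x (RC_self _ _)]
      exact hx
    · intro y hy
      by_cases h1 : y ∈ RC x K
      · exact Or.inl (hNk h1)
      by_cases h2 : y ∈ RC (p • x) L
      · right
        rw [← (e2 y h2).2]
        exact hNk (e2 y h2).1
      · exact absurd (hu3 y h1 h2) hy
    · intro y
      by_cases h1 : y ∈ RC x K
      · exact Or.inr (e1 y h1)
      by_cases h2 : y ∈ RC (p • x) L
      · exact Or.inr (e2 y h2).2
      · exact Or.inl (hu3 y h1 h2)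
  inv := by
    intro y U hU hy
    obtain ⟨N, hN⟩ := RC_basis U hU y hy
    obtain ⟨b, hb⟩ := rother hn (y N)
    have hq : Function.update y N b ∈ RC y N := by
      intro i hi
      rw [Function.update_of_ne (by omega)]
    have hqN : Function.update y N b N = b := Function.update_self ..
    generalize Function.update y N b = q at *
    have hd : Disjoint (RC y (N + 1)) (RC q (N + 1)) :=
      RC_disj (i := N) (by omega) (by omega) (by rw [hqN]; exact hb.symm)
    have hAU : RC y (N + 1) ⊆ U := (RC_sub y (by omega) y (RC_self _ _)).trans (hN N le_rfl)
    have hBU : RC q (N + 1) ⊆ U := (RC_sub y (by omega) q hq).trans (hN N le_rfl)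
    obtain ⟨s, hs, hsA, hsB, hs0⟩ := rsw G y (N + 1) q (N + 1) hd
    have hmA : ∀ z ∈ RC y (N + 1), s • z ≠ z := fun z hz h =>
      Set.disjoint_right.1 hd (hsA z hz) (by rw [h]; exact hz)
    have hmB : ∀ z ∈ RC q (N + 1), s • z ≠ z := fun z hz h =>
      Set.disjoint_left.1 hd (hsB z hz) (by rw [h]; exact hz)
    have hm : ∀ z, s • z ≠ z → z ∈ RC y (N + 1) ∨ z ∈ RC q (N + 1) := by
      intro z hz
      by_contra hc
      push Not at hc
      exact hz (hs0 z hc.1 hc.2)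
    refine ⟨s, hs, hmA y (RC_self _ _), ?_, RC y (N + 1), (RC_clopen _ _).isOpen, RC_self _ _, ?_⟩
    · intro z hz
      rcases hm z hz with h | h
      · exact hAU h
      · exact hBU h
    · intro c hc z hzc hz
      obtain ⟨M, hM⟩ := RC_basis c hc z hzc
      have hMc := hM (M + N + 1) (by omega)
      rcases hm z hz with h | h
      · have hsub : RC z (M + N + 1) ⊆ RC y (N + 1) := RC_sub y (by omega) z h
        obtain ⟨t, -, htB, htc, ht0⟩ := rsw G q (N + 1) z (M + N + 1) (hd.symm.mono_right hsub)
        refine ⟨t * s, ?_, ?_⟩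
        · intro w hw hsw
          rw [mul_smul, hsw] at hw
          apply hw
          apply ht0
          · exact fun h => hmB w h hsw
          · exact fun h => hmA w (hsub h) hsw
        · intro w hw
          rw [mul_smul]
          exact hMc (htB _ (hsA w hw))
      · have hsub : RC z (M + N + 1) ⊆ RC q (N + 1) := RC_sub q (by omega) z h
        obtain ⟨t, -, htA, htc, ht0⟩ := rsw G y (N + 1) z (M + N + 1) (hd.mono_right hsub)
        refine ⟨t, ?_, ?_⟩
        · intro w hw hsw
          apply hw
          apply ht0
          · exact fun h => hmA w h hsw
          · exact fun h => hmB w (hsub h) hsw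
        · intro w hw
          exact hMc (htA _ hw)
  three := by
    rintro U hU ⟨x, hx⟩
    obtain ⟨N, hN⟩ := RC_basis U hU x hx
    obtain ⟨b, hb⟩ := rother hn (x N)
    obtain ⟨c, hc⟩ := rother hn (x (N + 1))
    have hq : Function.update x N b ∈ RC x N := by
      intro i hi
      rw [Function.update_of_ne (by omega)]
    have hqN : Function.update x N b N = b := Function.update_self ..
    have hr : Function.update x (N + 1) c ∈ RC x N := by
      intro i hi
      rw [Function.update_of_ne (by omega)]
    have hrN : Function.update x (N + 1) c N = x N := Function.update_of_ne (by omega) ..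
    have hrN' : Function.update x (N + 1) c (N + 1) = c := Function.update_self ..
    generalize Function.update x N b = q at *
    generalize Function.update x (N + 1) c = r at *
    have hxq : Disjoint (RC x (N + 2)) (RC q (N + 2)) :=
      RC_disj (i := N) (by omega) (by omega) (by rw [hqN]; exact hb.symm)
    have hqr : Disjoint (RC q (N + 2)) (RC r (N + 2)) :=
      RC_disj (i := N) (by omega) (by omega) (by rw [hqN, hrN]; exact hb)
    have hxr : Disjoint (RC x (N + 2)) (RC r (N + 2)) :=
      RC_disj (i := N + 1) (by omega) (by omega) (by rw [hrN']; exact hc.symm)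
    have hU' : ∀ p ∈ RC x N, RC p (N + 2) ⊆ U := fun p hp =>
      (RC_sub x (by omega) p hp).trans (hN N le_rfl)
    obtain ⟨s, -, hs1, hs2, hs0⟩ := rsw G x (N + 2) q (N + 2) hxq
    obtain ⟨t, -, ht1, ht2, ht0⟩ := rsw G q (N + 2) r (N + 2) hqr
    refine ⟨t * s, ?_, x, ?_⟩
    · intro z hz
      by_contra hzU
      apply hz
      have h1 : z ∉ RC x (N + 2) := fun h => hzU (hU' x (RC_self _ _) h)
      have h2 : z ∉ RC q (N + 2) := fun h => hzU (hU' q hq h)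
      have h3 : z ∉ RC r (N + 2) := fun h => hzU (hU' r hr h)
      rw [mul_smul, hs0 z h1 h2, ht0 z h2 h3]
    · intro h
      have h1 : t • s • x ∈ RC r (N + 2) := ht1 _ (hs1 x (RC_self _ _))
      have h2 : s • t • s • x = t • s • x :=
        hs0 _ (Set.disjoint_right.1 hxr h1) (Set.disjoint_right.1 hqr h1)
      have h3 : t • s • t • s • x ∈ RC q (N + 2) := by
        rw [h2]
        exact ht2 _ h1
      simp only [mul_smul] at h
      rw [h] at h3
      exact Set.disjoint_left.1 hxq (RC_self _ _) h3

end CantorSide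

/-- Rubin's theorem applied to `V_n(G)` and `V_m(H)`.  Any group
isomorphism `φ : V_n(G) → V_m(H)` is realised by a unique homeomorphism `ψ` of
the underlying Cantor spaces, via `(v)φ = ψ⁻¹ ∘ v ∘ ψ` (apply `ψ⁻¹`, then `v`,
then `ψ`). -/
theorem rubin_conjugator_exists_unique (n m : ℕ) (hn : 2 ≤ n) (hm : 2 ≤ m)
    (G : Subgroup (Equiv.Perm (Fin n))) (H : Subgroup (Equiv.Perm (Fin m)))
    (φ : VnG n G ≃* VnG m H) :
    ∃! ψ : Cantor n ≃ₜ Cantor m, ∀ v : VnG n G, ∀ x : Cantor m,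
      ((φ v : Cantor m ≃ₜ Cantor m)) x = ψ ((v : Cantor n ≃ₜ Cantor n) (ψ.symm x)) := by
  exact rubin_abs (VnG_good G hn) (VnG_good H hm) φ
end

section
/- Let n ≥ 2 and let g ∈ S_n with g ≠ id such that x·g = x for some x ∈ {1,…,n}. Then the homeomorphism [∅]_g of 𝔠_n (which applies g to every letter of a sequence) is not conjugate in the homeomorphism group of 𝔠_n to any element of V_n; that is, for every homeomorphism ψ of 𝔠_n, the homeomorphism ψ^{-1} ∘ [∅]_g ∘ ψ does not lie in V_n. -/
open scoped Classical Pointwise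

/-- local prefix replacement at `p` with depths `a`, `b`. -/
def LocAt {n : ℕ} (v : Cantor n → Cantor n) (p : Cantor n) (a b : ℕ) : Prop :=
  ∀ q : Cantor n, (∀ i < a, q i = p i) →
    (∀ j < b, v q j = v p j) ∧ ∀ i, v q (b + i) = q (a + i)

theorem LocAt.succ {n : ℕ} {v : Cantor n → Cantor n} {p : Cantor n} {a b : ℕ}
    (h : LocAt v p a b) (k : ℕ) : LocAt v p (a + k) (b + k) := by
  intro q hq
  have h1 := h q (fun i hi => hq i (by omega))
  have h2 := h p (fun i _ => rfl)
  refine ⟨fun j hj => ?_, fun i => ?_⟩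
  · by_cases hjb : j < b
    · exact h1.1 j hjb
    · obtain ⟨i, rfl⟩ := Nat.exists_eq_add_of_le (not_lt.mp hjb)
      rw [h1.2, h2.2]
      exact hq _ (by omega)
  · rw [add_assoc, h1.2, add_assoc]

theorem LocAt.comp {n : ℕ} {v w : Cantor n → Cantor n} {p : Cantor n} {a b d : ℕ}
    (h : LocAt v p a b) (h' : LocAt w (v p) b d) : LocAt (fun x => w (v x)) p a d := by
  intro q hq
  have h1 := h q hq
  have h2 := h' (v q) h1.1
  exact ⟨h2.1, fun i => (h2.2 i).trans (h1.2 i)⟩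

theorem LocAt.inv {n : ℕ} {v : Cantor n ≃ₜ Cantor n} {p : Cantor n} {a b : ℕ}
    (h : LocAt v p a b) : LocAt v.symm (v p) b a := by
  intro q hq
  have key : v.symm q = fun i => if i < a then p i else q (b + (i - a)) := by
    rw [Homeomorph.symm_apply_eq]
    have h1 := h (fun i => if i < a then p i else q (b + (i - a)))
      (fun i hi => by simp [hi])
    funext j
    by_cases hjb : j < b
    · rw [h1.1 j hjb, hq j hjb]
    · obtain ⟨i, rfl⟩ := Nat.exists_eq_add_of_le (not_lt.mp hjb)
      rw [h1.2]
      simp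
  rw [key]
  refine ⟨fun j hj => by simp [hj], fun i => by simp⟩

theorem IsPrefixMap.loc {n : ℕ} {v : Cantor n → Cantor n} (h : IsPrefixMap v) (p : Cantor n) :
    ∃ a b, LocAt v p a b := by
  obtain ⟨t, α, β, hα, -, hv⟩ := h
  obtain ⟨i, hi, -⟩ := hα p
  have key : ∀ q, inCone (α i) q → q = appendWord (α i) (fun k => q ((α i).length + k)) := by
    intro q hq
    funext j
    unfold appendWord
    split_ifs with hj
    · exact hq j hj
    · simp only
      congr 1
      omega
  have key2 : ∀ q, inCone (α i) q →
      v q = appendWord (β i) (fun k => q ((α i).length + k)) := by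
    intro q hq
    conv_lhs => rw [key q hq]
    exact hv _ _
  refine ⟨(α i).length, (β i).length, fun q hq => ?_⟩
  have hq' : inCone (α i) q := fun j hj => (hq j hj).trans (hi j hj)
  rw [key2 q hq', key2 p hi]
  refine ⟨fun j hj => by simp [appendWord, hj], fun j => by simp [appendWord]⟩

theorem mem_loc {n : ℕ} {v : Cantor n ≃ₜ Cantor n} (h : v ∈ HigmanThompson n) :
    ∀ p, ∃ a b, LocAt v p a b := by
  unfold HigmanThompson at h
  induction h using Subgroup.closure_induction with
  | mem x hx => exact fun p => IsPrefixMap.loc hx p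
  | one => exact fun p => ⟨0, 0, fun q _ => ⟨fun j hj => by omega, fun i => rfl⟩⟩
  | mul w v _ _ hw hv =>
    intro p
    obtain ⟨a, b, h1⟩ := hv p
    obtain ⟨c, d, h2⟩ := hw (v p)
    have h1' := h1.succ c
    have h2' := h2.succ b
    rw [add_comm c b] at h2'
    exact ⟨_, _, h1'.comp h2'⟩
  | inv v _ hv =>
    intro p
    obtain ⟨a, b, h1⟩ := hv (v.symm p)
    have := h1.inv
    rw [Homeomorph.apply_symm_apply] at this
    exact ⟨_, _, this⟩

theorem contract {n : ℕ} {v : Cantor n → Cantor n} {p q : Cantor n} {a b m : ℕ}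
    (h : LocAt v p a b) (hp : v p = p) (hab : a < b) (hm : 0 < m)
    (hv : ∀ r, v^[m] r = r) (hq : ∀ i < a, q i = p i) : q = p := by
  have key : ∀ k, ∀ i < a + k, v^[k] q i = p i := by
    intro k
    induction k with
    | zero => simpa using hq
    | succ k ih =>
      intro i hi
      rw [Function.iterate_succ_apply']
      obtain ⟨c, rfl⟩ := Nat.exists_eq_add_of_lt hab
      have := (h.succ k) _ ih
      rw [this.1 i (by omega), hp]
  funext i
  have h2 : v^[m * (i + 1)] q = q := by
    rw [Function.iterate_mul]
    have : v^[m] = id := funext hv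
    rw [this]; simp
  rw [← key (m * (i + 1)) i (by nlinarith), h2]

/-- If `g ∈ S_n` is a nontrivial permutation with a fixed point,
then the homeomorphism `[∅]_g` (applying `g` to every letter of a sequence) is
not conjugate in the homeomorphism group of the Cantor space to any element of
`V_n`.  (The conjugate `ψ⁻¹ ∘ [∅]_g ∘ ψ` applies `ψ⁻¹` first, then `[∅]_g`,
then `ψ`, i.e. it is `ψ * f * ψ⁻¹` in our convention.) -/
theorem iterPerm_not_conjugate_into_vn (n : ℕ) (hn : 2 ≤ n)
    (g : Equiv.Perm (Fin n)) (hg : g ≠ 1) (x : Fin n) (hx : g x = x) :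
    ∀ ψ f : Cantor n ≃ₜ Cantor n, (∀ χ k, f χ k = g (χ k)) →
      ψ * f * ψ⁻¹ ∉ HigmanThompson n := by
  intro ψ f hf hmem
  obtain ⟨y, hy⟩ : ∃ y, g y ≠ y := by
    by_contra hcon
    push Not at hcon
    exact hg (Equiv.ext hcon)
  set v : Cantor n ≃ₜ Cantor n := ψ * f * ψ⁻¹ with hvdef
  have vapp : ∀ r, v r = ψ (f (ψ.symm r)) := fun r => rfl
  have vψ : ∀ r, v (ψ r) = ψ (f r) := fun r => by rw [vapp, Homeomorph.symm_apply_apply]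
  have fiter : ∀ m r k, (⇑f)^[m] r k = (g ^ m) (r k) := by
    intro m
    induction m with
    | zero => intro r k; rfl
    | succ m ih =>
      intro r k
      rw [Function.iterate_succ_apply, ih, hf, pow_succ]; rfl
  have viter : ∀ m r, (⇑v)^[m] (ψ r) = ψ ((⇑f)^[m] r) := by
    intro m
    induction m with
    | zero => intro r; rfl
    | succ m ih =>
      intro r
      rw [Function.iterate_succ_apply, vψ, ih, Function.iterate_succ_apply]
  have hm : 0 < orderOf g := orderOf_pos g
  have vord : ∀ r, (⇑v)^[orderOf g] r = r := by
    intro r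
    obtain ⟨s, rfl⟩ := ψ.surjective r
    rw [viter]
    congr 1
    funext k
    rw [fiter, pow_orderOf_eq_one]; rfl
  have vord' : ∀ r, (⇑v.symm)^[orderOf g] r = r := by
    intro r
    conv_lhs => rw [← vord r]
    exact Function.LeftInverse.iterate v.symm_apply_apply _ r
  set p : Cantor n := ψ (fun _ => x) with hpdef
  have hp : v p = p := by
    rw [hpdef, vψ]
    congr 1
    funext k
    rw [hf, hx]
  have hp' : v.symm p = p := by rw [Homeomorph.symm_apply_eq, hp]
  have hq : ∀ a : ℕ, ∃ q : Cantor n, (∀ i < a, q i = p i) ∧ v q ≠ q := by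
    intro a
    let s : ℕ → Cantor n := fun N i => if i < N then x else y
    have hs : Filter.Tendsto s Filter.atTop (nhds (fun _ => x)) := by
      rw [tendsto_pi_nhds]
      intro i
      apply tendsto_const_nhds.congr'
      filter_upwards [Filter.eventually_gt_atTop i] with N hN
      simp [s, hN]
    have hs2 := (ψ.continuous.tendsto (fun _ => x)).comp hs
    rw [tendsto_pi_nhds] at hs2
    have hs3 : ∀ᶠ N in Filter.atTop, ∀ i ∈ Finset.range a, ψ (s N) i = p i := by
      rw [Filter.eventually_all_finset]
      intro i _
      have := hs2 i
      rw [nhds_discrete, Filter.tendsto_pure] at this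
      exact this
    obtain ⟨N, hN⟩ := hs3.exists
    refine ⟨ψ (s N), fun i hi => hN i (Finset.mem_range.2 hi), fun heq => ?_⟩
    rw [vψ] at heq
    have := congrFun (ψ.injective heq) N
    rw [hf] at this
    simp [s] at this
    exact hy this
  obtain ⟨a, b, hloc⟩ := mem_loc hmem p
  rcases lt_trichotomy a b with hab | hab | hab
  · obtain ⟨q, hq1, hq2⟩ := hq a
    apply hq2
    rw [contract hloc hp hab hm vord hq1, hp]
  · subst hab
    obtain ⟨q, hq1, hq2⟩ := hq a
    apply hq2
    have h1 := hloc q hq1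
    funext j
    by_cases hj : j < a
    · rw [hq1 j hj]
      have := h1.1 j hj
      rw [hp] at this
      exact this
    · obtain ⟨i, rfl⟩ := Nat.exists_eq_add_of_le (not_lt.mp hj)
      exact h1.2 i
  · obtain ⟨q, hq1, hq2⟩ := hq b
    apply hq2
    have h2 := hloc.inv
    rw [hp] at h2
    rw [contract h2 hp' hab hm vord' hq1, hp]
end

section
/- For every n ≥ 2, the Higman–Thompson group V_n acts locally densely on 𝔠_n: for every point x ∈ 𝔠_n and every open neighborhood U of x, the closure of the set {x·g : g ∈ V_n, g restricts to the identity on 𝔠_n \ U} contains a nonempty open subset of 𝔠_n. -/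
open scoped Classical Pointwise

/-- Apply a permutation of words of length `M` to the prefix of a sequence. -/
def prefMap {n M : ℕ} (σ : Equiv.Perm (Fin M → Fin n)) (z : Cantor n) : Cantor n :=
  fun i => if h : i < M then σ (fun j : Fin M => z j) ⟨i, h⟩ else z i

lemma prefMap_pref {n M : ℕ} (σ : Equiv.Perm (Fin M → Fin n)) (z : Cantor n) :
    (fun j : Fin M => prefMap σ z j) = σ (fun j : Fin M => z j) := by
  funext j
  simp [prefMap]

lemma prefMap_inv {n M : ℕ} (σ τ : Equiv.Perm (Fin M → Fin n)) (h : ∀ w, τ (σ w) = w)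
    (z : Cantor n) : prefMap τ (prefMap σ z) = z := by
  funext i
  by_cases hi : i < M
  · have : prefMap τ (prefMap σ z) i = τ (fun j : Fin M => prefMap σ z j) ⟨i, hi⟩ := by
      rw [prefMap, dif_pos hi]
    rw [this, prefMap_pref, h]
  · simp [prefMap, hi]

lemma prefMap_cont {n M : ℕ} (σ : Equiv.Perm (Fin M → Fin n)) :
    Continuous (prefMap σ) := by
  refine continuous_pi fun i => ?_
  by_cases hi : i < M
  · simp only [prefMap, hi, dif_pos]
    have h1 : Continuous (fun w : Fin M → Fin n => σ w ⟨i, hi⟩) := continuous_of_discreteTopology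
    exact h1.comp (continuous_pi fun j => continuous_apply (j : ℕ))
  · simp only [prefMap, hi, dif_neg, not_false_eq_true]
    exact continuous_apply i

/-- The homeomorphism given by a permutation of prefixes. -/
def prefHomeo {n M : ℕ} (σ : Equiv.Perm (Fin M → Fin n)) : Cantor n ≃ₜ Cantor n where
  toFun := prefMap σ
  invFun := prefMap σ.symm
  left_inv := prefMap_inv _ _ (by simp)
  right_inv := prefMap_inv _ _ (by simp)
  continuous_toFun := prefMap_cont _
  continuous_invFun := prefMap_cont _

lemma inCone_ofFn {n M : ℕ} (w : Fin M → Fin n) (x : Cantor n) :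
    inCone (List.ofFn w) x ↔ w = fun j : Fin M => x j := by
  constructor
  · intro h
    funext j
    have := h j (by simp)
    simpa using this.symm
  · rintro rfl i hi
    simp

lemma append_ofFn_pref {n M : ℕ} (w : Fin M → Fin n) (x : Cantor n) :
    (fun j : Fin M => appendWord (List.ofFn w) x j) = w := by
  funext j
  simp [appendWord]

lemma prefHomeo_isPrefixMap {n M : ℕ} (σ : Equiv.Perm (Fin M → Fin n)) :
    IsPrefixMap ⇑(prefHomeo σ) := by
  let e := (Fintype.equivFin (Fin M → Fin n)).symm
  have key : ∀ (f : Fin (Fintype.card (Fin M → Fin n)) ≃ (Fin M → Fin n)) (x : Cantor n),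
      ∃! i, inCone (List.ofFn (f i)) x := by
    intro f x
    simp only [inCone_ofFn]
    exact f.bijective.existsUnique _
  refine ⟨_, fun i => List.ofFn (e i), fun i => List.ofFn (σ (e i)), key e, key (e.trans σ), ?_⟩
  intro i γ
  change prefMap σ _ = _
  funext k
  by_cases hk : k < M
  · rw [prefMap, dif_pos hk, append_ofFn_pref]
    simp [appendWord, hk]
  · simp [prefMap, appendWord, hk]

lemma open_pref {n : ℕ} {O : Set (Cantor n)} (hO : IsOpen O) {y : Cantor n} (hy : y ∈ O) :
    ∃ M : ℕ, ∀ z : Cantor n, (∀ i < M, z i = y i) → z ∈ O := by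
  obtain ⟨I, u, hu, hsub⟩ := isOpen_pi_iff.1 hO y hy
  refine ⟨I.sup id + 1, fun z hz => hsub fun i hi => ?_⟩
  have : i ≤ I.sup id := Finset.le_sup (f := id) hi
  rw [hz i (by omega)]
  exact (hu i hi).2

/-- `V_n` acts locally densely on the `n`-ary Cantor space: for
every point `x` and open neighbourhood `U` of `x`, the closure of the orbit of
`x` under the elements of `V_n` supported in `U` contains a nonempty open set. -/
theorem vn_locally_dense (n : ℕ) (hn : 2 ≤ n) :
    ∀ x : Cantor n, ∀ U : Set (Cantor n), IsOpen U → x ∈ U →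
      ∃ V : Set (Cantor n), V.Nonempty ∧ IsOpen V ∧
        V ⊆ closure {y | ∃ v ∈ HigmanThompson n, (∀ z ∉ U, v z = z) ∧ v x = y} := by
  intro x U hU hx
  obtain ⟨N, hN⟩ := open_pref hU hx
  refine ⟨{z | (fun j : Fin N => z j) = fun j : Fin N => x j}, ⟨x, rfl⟩, ?_, ?_⟩
  · have hc : Continuous (fun z : Cantor n => (fun j : Fin N => z j)) :=
      continuous_pi fun j => continuous_apply (j : ℕ)
    exact (isOpen_discrete {fun j : Fin N => x j}).preimage hc
  intro y hy
  have hy' : ∀ i < N, y i = x i := fun i hi => congrFun hy ⟨i, hi⟩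
  rw [mem_closure_iff]
  intro O hO hyO
  obtain ⟨M₀, hM₀⟩ := open_pref hO hyO
  let M := max N M₀
  let σ : Equiv.Perm (Fin M → Fin n) := Equiv.swap (fun j : Fin M => x j) (fun j : Fin M => y j)
  refine ⟨prefHomeo σ x, hM₀ _ fun i hi => ?_, prefHomeo σ,
    Subgroup.subset_closure (prefHomeo_isPrefixMap σ), fun z hz => ?_, rfl⟩
  · have hiM : i < M := lt_of_lt_of_le hi (le_max_right _ _)
    change prefMap σ x i = y i
    rw [prefMap, dif_pos hiM]
    simp [σ]
  · have hzx : (fun j : Fin M => z j) ≠ (fun j : Fin M => x j) := fun h =>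
      hz (hN z fun i hi => congrFun h ⟨i, lt_of_lt_of_le hi (le_max_left _ _)⟩)
    have hzy : (fun j : Fin M => z j) ≠ (fun j : Fin M => y j) := fun h =>
      hz (hN z fun i hi =>
        (congrFun h ⟨i, lt_of_lt_of_le hi (le_max_left _ _)⟩).trans (hy' i hi))
    change prefMap σ z = z
    funext i
    by_cases hi : i < M
    · rw [prefMap, dif_pos hi]
      simp only [σ]
      rw [Equiv.swap_apply_of_ne_of_ne hzx hzy]
    · simp [prefMap, hi]
end
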